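/- Fix ν > 0 and an integer d ≥ 1, and let (n_m)_{m≥1} be a sequence of integers diverging to infinity. For each m, let W_m be a degenerate U-statistic of order d based on independent random variables X_1^{(m)}, …, X_{n_m}^{(m)}, with W_m ∈ L⁴(P), E[W_m] = 0 and E[W_m²] = 2ν, and let ρ_{n_m}² and D_{n_m} be the associated quantities. If E[W_m⁴] − 12E[W_m³] − 12ν² + 48ν → 0 and D_{n_m}·ρ_{n_m}² → 0 as m → ∞, then W_m converges in distribution to Z_ν. -/

import Mathlib

open MeasureTheory ProbabilityTheory Real Filter Topology

namespace DJ

/-! ### Part A: commuting projections in an inner product space -/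

/-- `Deg P k s U`: every product of `k+1` distinct `P i`, `i ∈ s`, kills `U`. -/
def Deg {ι H : Type*} [DecidableEq ι] [NormedAddCommGroup H] [InnerProductSpace ℝ H]
    (P : ι → H →ₗ[ℝ] H) : ℕ → Finset ι → H → Prop
  | 0, s, U => ∀ i ∈ s, P i U = 0
  | k + 1, s, U => ∀ i ∈ s, Deg P k (s.erase i) (P i U)

section A
variable {ι H : Type*} [DecidableEq ι] [NormedAddCommGroup H] [InnerProductSpace ℝ H]
  (P : ι → H →ₗ[ℝ] H)

lemma deg_zero (k : ℕ) : ∀ s : Finset ι, Deg P k s 0 := by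
  induction k with
  | zero => intro s i _; simp
  | succ k ih => intro s i _; simpa using ih (s.erase i)

lemma deg_add (k : ℕ) : ∀ (s : Finset ι) (U V : H), Deg P k s U → Deg P k s V →
    Deg P k s (U + V) := by
  induction k with
  | zero => intro s U V hU hV i hi; simp [hU i hi, hV i hi]
  | succ k ih =>
    intro s U V hU hV i hi
    rw [map_add]; exact ih _ _ _ (hU i hi) (hV i hi)

lemma deg_smul (k : ℕ) (c : ℝ) : ∀ (s : Finset ι) (U : H), Deg P k s U →
    Deg P k s (c • U) := by
  induction k with
  | zero => intro s U hU i hi; simp [hU i hi]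
  | succ k ih =>
    intro s U hU i hi
    rw [map_smul]; exact ih _ _ (hU i hi)

lemma deg_sum {α : Type*} (k : ℕ) (s : Finset ι) (t : Finset α) (U : α → H)
    (h : ∀ x ∈ t, Deg P k s (U x)) : Deg P k s (∑ x ∈ t, U x) := by
  classical
  induction t using Finset.induction_on with
  | empty => simpa using deg_zero P k s
  | insert x t hx ih =>
    rw [Finset.sum_insert hx]
    exact deg_add P k s _ _ (h x (by simp)) (ih fun y hy => h y (by simp [hy]))

lemma deg_key (hsym : ∀ i x y, inner ℝ (P i x) y = inner ℝ x (P i y))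
    (hid : ∀ i x, P i (P i x) = P i x) (hcomm : ∀ i j x, P i (P j x) = P j (P i x)) (k : ℕ) :
    ∀ (s : Finset ι) (U : H), Deg P k s U →
      ‖∑ i ∈ s, P i U‖ ^ 2 ≤ k * inner ℝ (∑ i ∈ s, P i U) U := by
  induction k with
  | zero =>
    intro s U hU
    have : ∑ i ∈ s, P i U = 0 := Finset.sum_eq_zero hU
    simp [this]
  | succ k ih =>
    intro s U hU
    have hb : ∀ i ∈ s, inner ℝ (∑ j ∈ s.erase i, P j (P i U)) (P i U) ≤ k * ‖P i U‖ ^ 2 := by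
      intro i hi
      have h1 := ih _ _ (hU i hi)
      set V := P i U
      set Y := ∑ j ∈ s.erase i, P j V
      have h2 : inner ℝ Y V ≤ ‖Y‖ * ‖V‖ := real_inner_le_norm Y V
      have hk : (0:ℝ) ≤ k := Nat.cast_nonneg k
      have h3 : ‖Y‖ ≤ k * ‖V‖ := by
        by_contra hc
        push Not at hc
        have h4 : ‖Y‖ ^ 2 ≤ k * (‖Y‖ * ‖V‖) := h1.trans (by gcongr)
        have h5 : 0 < ‖Y‖ := lt_of_le_of_lt (by positivity) hc
        nlinarith
      nlinarith [norm_nonneg V]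
    have h1 : ∀ i ∈ s, inner ℝ (P i U) (∑ j ∈ s, P j U) ≤ (k + 1) * inner ℝ (P i U) U := by
      intro i hi
      have e1 : inner ℝ (P i U) (∑ j ∈ s, P j U)
          = inner ℝ (∑ j ∈ s, P j (P i U)) (P i U) := by
        rw [inner_sum, sum_inner]
        refine Finset.sum_congr rfl fun j _ => ?_
        rw [hcomm j i, ← hid i U, hsym i (P i U) (P j U), hid i U, real_inner_comm]
      rw [e1, ← Finset.add_sum_erase s _ hi, inner_add_left, hid]
      have e2 : inner ℝ (P i U) U = ‖P i U‖ ^ 2 := by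
        rw [← real_inner_self_eq_norm_sq, hsym i U (P i U), hid, real_inner_comm]
      rw [e2, real_inner_self_eq_norm_sq]
      linarith [hb i hi]
    rw [← real_inner_self_eq_norm_sq, sum_inner, sum_inner, Finset.mul_sum]
    push_cast
    exact Finset.sum_le_sum h1

lemma aux_le (U V : H) (c : ℝ) (hc : 0 < c) (h : c * ‖V‖ ^ 2 ≤ inner ℝ V U) :
    ‖U - c • V‖ ^ 2 ≤ inner ℝ (U - c • V) U := by
  rw [← real_inner_self_eq_norm_sq]
  simp only [inner_sub_left, inner_sub_right, inner_smul_left, inner_smul_right, conj_trivial]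
  rw [real_inner_self_eq_norm_sq V, real_inner_comm V U]
  nlinarith [mul_le_mul_of_nonneg_left h hc.le]

/-- The abstract form of the carré-du-champ variance bound. -/
lemma hilbert_bound [Fintype ι]
    (hsym : ∀ i x y, inner ℝ (P i x) y = inner ℝ x (P i y))
    (hid : ∀ i x, P i (P i x) = P i x) (hcomm : ∀ i j x, P i (P j x) = P j (P i x))
    (d : ℕ) (hd : 1 ≤ d) (ν : ℝ) (w2 w o : H) (r2 rd a : ι → H)
    (h1 : ∀ i, w2 = r2 i + (2:ℝ) • rd i + a i)
    (h2 : ∀ i, P i (r2 i) = 0) (h3 : ∀ i, P i (rd i) = rd i)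
    (h4 : ∀ i, inner ℝ (rd i) (rd i) = inner ℝ (a i) (r2 i))
    (h5 : ∑ i, (rd i + a i) = (d:ℝ) • w2)
    (h6 : ∑ i, P i w = (d:ℝ) • w) (h7 : ∀ i, P i o = 0)
    (ho : inner ℝ o o = (1:ℝ)) (hwo : inner ℝ w o = (0:ℝ)) (hww : inner ℝ w w = 2 * ν)
    (hw2o : inner ℝ w2 o = 2 * ν)
    (hg2 : Deg P (2 * d) Finset.univ w2) (hg1 : Deg P (2 * d) Finset.univ w)
    (hg0 : Deg P (2 * d) Finset.univ o) :
    3 * ‖(2 * d : ℝ)⁻¹ • (∑ i, ((2:ℝ) • a i - P i (a i))) - (2:ℝ) • w - (2 * ν) • o‖ ^ 2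
      ≤ inner ℝ w2 w2 - 12 * inner ℝ w2 w - 12 * ν ^ 2 + 48 * ν + 2 * ∑ i, ‖a i‖ ^ 2 := by
  have hd0 : (1:ℝ) ≤ d := by exact_mod_cast hd
  have hdne : (d:ℝ) ≠ 0 := by positivity
  set Lw : H := ∑ i, P i w2 with hLw
  set S : H := ∑ i, ((2:ℝ) • a i - P i (a i)) with hS
  -- P w2
  have hP : ∀ i, P i w2 = (2:ℝ) • (rd i + a i) - ((2:ℝ) • a i - P i (a i)) := by
    intro i
    conv_lhs => rw [h1 i]
    rw [map_add, map_add, map_smul, h2, h3]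
    module
  have hLS : Lw = (2 * d : ℝ) • w2 - S := by
    rw [hLw, hS]
    simp_rw [hP]
    rw [Finset.sum_sub_distrib, ← Finset.smul_sum, h5, smul_smul]
  set U : H := w2 - (2 * ν) • o - (4:ℝ) • w with hU
  have hLU : ∑ i, P i U = Lw - (4 * d : ℝ) • w := by
    have : ∀ i, P i U = P i w2 - (4:ℝ) • P i w := by
      intro i; rw [hU]; simp [h7]
    simp_rw [this]
    rw [Finset.sum_sub_distrib, ← Finset.smul_sum, h6, smul_smul]
  have hdegU : Deg P (2 * d) Finset.univ U := by
    have : U = w2 + (-(2 * ν)) • o + (-4:ℝ) • w := by rw [hU]; module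
    rw [this]
    exact deg_add _ _ _ _ _ (deg_add _ _ _ _ _ hg2 (deg_smul _ _ _ _ _ hg0))
      (deg_smul _ _ _ _ _ hg1)
  have hkey := deg_key P hsym hid hcomm (2 * d) Finset.univ U hdegU
  set LU : H := ∑ i, P i U with hLUdef
  have hAU : (2 * d : ℝ)⁻¹ • S - (2:ℝ) • w - (2 * ν) • o = U - (2 * d : ℝ)⁻¹ • LU := by
    rw [hLU, hLS, hU]
    simp only [smul_sub, smul_smul]
    have e1 : ((2 * d : ℝ)⁻¹ * (2 * d)) = 1 := by field_simp
    have e2 : ((2 * d : ℝ)⁻¹ * (4 * d)) = 2 := by field_simp; norm_num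
    rw [e1, e2]; module
  -- ‖AU‖² ≤ ⟨AU, U⟩
  have hle : ‖U - (2 * d : ℝ)⁻¹ • LU‖ ^ 2 ≤ inner ℝ (U - (2 * d : ℝ)⁻¹ • LU) U := by
    push_cast at hkey
    refine aux_le _ _ _ (by positivity) ?_
    rw [inv_mul_le_iff₀ (by positivity)]; exact hkey
  -- symmetric: compute ⟨AU,U⟩
  have hLo : ∀ x : H, inner ℝ (∑ i, P i x) o = (0:ℝ) := by
    intro x; rw [sum_inner]
    exact Finset.sum_eq_zero fun i _ => by rw [hsym, h7, inner_zero_right]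
  have hLww : inner ℝ Lw w = d * inner ℝ w2 w := by
    have : inner ℝ Lw w = inner ℝ w2 (∑ i, P i w) := by
      rw [hLw, sum_inner, inner_sum]; exact Finset.sum_congr rfl fun i _ => hsym _ _ _
    rw [this, h6, inner_smul_right]
  have hSw2 : 3 * inner ℝ S w2 ≤ 2 * d * inner ℝ w2 w2 + 4 * ∑ i, ‖a i‖ ^ 2 := by
    have e : d * inner ℝ w2 w2 = ∑ i, inner ℝ (rd i + a i) w2 := by
      rw [← sum_inner, h5, inner_smul_left]; simp
    have e' : 2 * d * inner ℝ w2 w2 = ∑ i, 2 * inner ℝ (rd i + a i) w2 := by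
      rw [← Finset.mul_sum, ← e]; ring
    rw [e', hS, sum_inner, Finset.mul_sum, Finset.mul_sum, ← Finset.sum_add_distrib]
    refine Finset.sum_le_sum fun i _ => ?_
    have q1 : inner ℝ (rd i) (r2 i) = (0:ℝ) := by
      rw [← h3, hsym, h2, inner_zero_right]
    have q2 : inner ℝ (P i (a i)) (r2 i) = (0:ℝ) := by rw [hsym, h2, inner_zero_right]
    have q3 : inner ℝ (P i (a i)) (rd i) = inner ℝ (rd i) (a i) := by
      rw [hsym, h3, real_inner_comm]
    have q4 : inner ℝ (P i (a i)) (a i) = inner ℝ (P i (a i)) (P i (a i)) := by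
      rw [hsym _ _ (P i (a i)), hid, real_inner_comm]
    have q5 : (0:ℝ) ≤ inner ℝ (P i (a i)) (P i (a i)) := real_inner_self_nonneg
    have q6 := h4 i
    have q7 : inner ℝ (a i) (rd i) = inner ℝ (rd i) (a i) := real_inner_comm _ _
    conv_lhs => rw [h1 i]
    conv_rhs => rw [h1 i]
    simp only [inner_add_right, inner_add_left, inner_sub_left, inner_smul_left,
      inner_smul_right, conj_trivial]
    rw [← real_inner_self_eq_norm_sq (a i)]
    rw [q1, q2, q3, q4, q6, q7]
    have q8 : (0:ℝ) ≤ inner ℝ (a i) (a i) := real_inner_self_nonneg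
    linarith
  rw [hAU]
  have hAUU : inner ℝ (U - (2 * d : ℝ)⁻¹ • LU) U
      = (2 * d : ℝ)⁻¹ * inner ℝ S w2 - 4 * ν ^ 2 - 4 * inner ℝ w2 w + 16 * ν := by
    rw [← hAU, hU]
    have hSo : inner ℝ S o = 2 * d * (2 * ν) := by
      have : S = (2 * d : ℝ) • w2 - Lw := by rw [hLS]; abel
      rw [this, inner_sub_left, hLo, inner_smul_left, hw2o]; simp
    have hSw : inner ℝ S w = d * inner ℝ w2 w := by
      have : S = (2 * d : ℝ) • w2 - Lw := by rw [hLS]; abel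
      rw [this, inner_sub_left, hLww, inner_smul_left]; simp; ring
    simp only [inner_sub_right, inner_sub_left, inner_smul_left,
      inner_smul_right, conj_trivial]
    rw [hSo, hSw, hww, hwo, ho, real_inner_comm w o, hwo, real_inner_comm w2 o, hw2o,
      real_inner_comm w2 w]
    field_simp
    ring
  have hfin : 3 * ((2 * d : ℝ)⁻¹ * inner ℝ S w2) ≤ inner ℝ w2 w2 + 2 * ∑ i, ‖a i‖ ^ 2 := by
    have h0 : 0 ≤ ∑ i, ‖a i‖ ^ 2 := Finset.sum_nonneg fun i _ => by positivity
    have : 3 * ((2 * d : ℝ)⁻¹ * inner ℝ S w2) = (2 * d : ℝ)⁻¹ * (3 * inner ℝ S w2) := by ring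
    rw [this, inv_mul_le_iff₀ (by positivity)]
    nlinarith
  linarith
end A
end DJ

namespace DJ

/-! ### Part B: a combinatorial hypercontractivity estimate -/

lemma sq_sum11 (x1 x2 x3 x4 x5 x6 x7 x8 x9 x10 x11 : ℝ) :
    (x1+x2+x3+x4+x5+x6+x7+x8+x9+x10+x11)^2 ≤
      11 * (x1^2+x2^2+x3^2+x4^2+x5^2+x6^2+x7^2+x8^2+x9^2+x10^2+x11^2) := by
  have := sq_sum_le_card_mul_sum_sq (s := (Finset.univ : Finset (Fin 11)))
    (f := ![x1,x2,x3,x4,x5,x6,x7,x8,x9,x10,x11])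
  simp [Fin.sum_univ_succ] at this
  ring_nf at this ⊢
  linarith

lemma one_coord (a0 a1 b0 b1 c0 c1 e0 e1 : ℝ) :
    a0*b0*c0*e0 + (a1*b1*c0*e0 + a1*b0*c1*e0 + a1*b0*c0*e1 + a0*b1*c1*e0 + a0*b1*c0*e1
      + a0*b0*c1*e1 + a1*b1*c1*e0 + a1*b1*c0*e1 + a1*b0*c1*e1 + a0*b1*c1*e1 + a1*b1*c1*e1)
    ≤ √((a0^2+16*a1^2)*(b0^2+16*b1^2)*(c0^2+16*c1^2)*(e0^2+16*e1^2)) := by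
  apply Real.le_sqrt_of_sq_le
  have h11 := sq_sum11 (a1*b1*c0*e0) (a1*b0*c1*e0) (a1*b0*c0*e1) (a0*b1*c1*e0) (a0*b1*c0*e1)
    (a0*b0*c1*e1) (a1*b1*c1*e0) (a1*b1*c0*e1) (a1*b0*c1*e1) (a0*b1*c1*e1) (a1*b1*c1*e1)
  set S := (a1*b1*c0*e0 + a1*b0*c1*e0 + a1*b0*c0*e1 + a0*b1*c1*e0 + a0*b1*c0*e1
      + a0*b0*c1*e1 + a1*b1*c1*e0 + a1*b1*c0*e1 + a1*b0*c1*e1 + a0*b1*c1*e1 + a1*b1*c1*e1) with hS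
  have hx : 2*(a0*b0*c0*e0)*S ≤ 7*((a1*b0*c0*e0)^2+(a0*b1*c0*e0)^2+(a0*b0*c1*e0)^2+(a0*b0*c0*e1)^2)
    + 5*((a1*b1*c0*e0)^2+(a1*b0*c1*e0)^2+(a1*b0*c0*e1)^2+(a0*b1*c1*e0)^2+(a0*b1*c0*e1)^2
      +(a0*b0*c1*e1)^2) := by
    have p1 := sq_nonneg (a1*b0*c0*e0 - a0*b1*c0*e0)
    have p2 := sq_nonneg (a1*b0*c0*e0 - a0*b0*c1*e0)
    have p3 := sq_nonneg (a1*b0*c0*e0 - a0*b0*c0*e1)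
    have p4 := sq_nonneg (a0*b1*c0*e0 - a0*b0*c1*e0)
    have p5 := sq_nonneg (a0*b1*c0*e0 - a0*b0*c0*e1)
    have p6 := sq_nonneg (a0*b0*c1*e0 - a0*b0*c0*e1)
    have t1 := sq_nonneg (a1*b1*c0*e0 - a0*b0*c1*e0)
    have t2 := sq_nonneg (a1*b1*c0*e0 - a0*b0*c0*e1)
    have t3 := sq_nonneg (a1*b0*c1*e0 - a0*b0*c0*e1)
    have t4 := sq_nonneg (a0*b1*c1*e0 - a0*b0*c0*e1)
    have f1 := sq_nonneg (a1*b1*c0*e0 - a0*b0*c1*e1)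
    have g1 := sq_nonneg (a1*b0*c0*e0)
    have g2 := sq_nonneg (a0*b1*c0*e0)
    have g3 := sq_nonneg (a0*b0*c1*e0)
    have g4 := sq_nonneg (a0*b0*c0*e1)
    have k1 := sq_nonneg (a1*b1*c0*e0)
    have k2 := sq_nonneg (a1*b0*c1*e0)
    have k3 := sq_nonneg (a1*b0*c0*e1)
    have k4 := sq_nonneg (a0*b1*c1*e0)
    have k5 := sq_nonneg (a0*b1*c0*e1)
    have k6 := sq_nonneg (a0*b0*c1*e1)
    rw [hS]
    ring_nf at p1 p2 p3 p4 p5 p6 t1 t2 t3 t4 f1 g1 g2 g3 g4 k1 k2 k3 k4 k5 k6 ⊢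
    linarith
  have hexp : (a0*b0*c0*e0 + S)^2 = (a0*b0*c0*e0)^2 + 2*(a0*b0*c0*e0)*S + S^2 := by ring
  rw [hexp]
  clear_value S
  have g1 := sq_nonneg (a1*b0*c0*e0)
  have g2 := sq_nonneg (a0*b1*c0*e0)
  have g3 := sq_nonneg (a0*b0*c1*e0)
  have g4 := sq_nonneg (a0*b0*c0*e1)
  have k1 := sq_nonneg (a1*b1*c0*e0)
  have k2 := sq_nonneg (a1*b0*c1*e0)
  have k3 := sq_nonneg (a1*b0*c0*e1)
  have k4 := sq_nonneg (a0*b1*c1*e0)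
  have k5 := sq_nonneg (a0*b1*c0*e1)
  have k6 := sq_nonneg (a0*b0*c1*e1)
  have l1 := sq_nonneg (a1*b1*c1*e0)
  have l2 := sq_nonneg (a1*b1*c0*e1)
  have l3 := sq_nonneg (a1*b0*c1*e1)
  have l4 := sq_nonneg (a0*b1*c1*e1)
  have l5 := sq_nonneg (a1*b1*c1*e1)
  have hR : (a0^2+16*a1^2)*(b0^2+16*b1^2)*(c0^2+16*c1^2)*(e0^2+16*e1^2)
     = (a0*b0*c0*e0)^2 + 16*((a1*b0*c0*e0)^2+(a0*b1*c0*e0)^2+(a0*b0*c1*e0)^2+(a0*b0*c0*e1)^2)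
     + 256*((a1*b1*c0*e0)^2+(a1*b0*c1*e0)^2+(a1*b0*c0*e1)^2+(a0*b1*c1*e0)^2+(a0*b1*c0*e1)^2
      +(a0*b0*c1*e1)^2) + 4096*((a1*b1*c1*e0)^2+(a1*b1*c0*e1)^2+(a1*b0*c1*e1)^2+(a0*b1*c1*e1)^2)
     + 65536*(a1*b1*c1*e1)^2 := by ring
  rw [hR]
  linarith

section B
variable {ι : Type*} [DecidableEq ι]

/-- No index is covered exactly once by the four sets. -/
def Ok (J K L M : Finset ι) : Prop :=
  J ⊆ K ∪ L ∪ M ∧ K ⊆ J ∪ L ∪ M ∧ L ⊆ J ∪ K ∪ M ∧ M ⊆ J ∪ K ∪ L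

instance (J K L M : Finset ι) : Decidable (Ok J K L M) := by unfold Ok; infer_instance

/-- insert or not -/
def ins (i : ι) (x : Bool) (J : Finset ι) : Finset ι := if x then insert i J else J

/-- patterns with no singleton -/
def okB : Bool → Bool → Bool → Bool → Bool
  | true, false, false, false => false
  | false, true, false, false => false
  | false, false, true, false => false
  | false, false, false, true => false
  | _, _, _, _ => true

lemma mem_ins {i j : ι} {x : Bool} {J : Finset ι} :
    j ∈ ins i x J ↔ (x = true ∧ j = i) ∨ j ∈ J := by
  unfold ins; cases x <;> simp

lemma ok_iff (J K L M : Finset ι) : Ok J K L M ↔ ∀ j,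
    (j ∈ J → j ∈ K ∨ j ∈ L ∨ j ∈ M) ∧ (j ∈ K → j ∈ J ∨ j ∈ L ∨ j ∈ M) ∧
    (j ∈ L → j ∈ J ∨ j ∈ K ∨ j ∈ M) ∧ (j ∈ M → j ∈ J ∨ j ∈ K ∨ j ∈ L) := by
  simp only [Ok, Finset.subset_iff, Finset.mem_union, or_assoc]
  constructor
  · rintro ⟨h1, h2, h3, h4⟩ j; exact ⟨@h1 j, @h2 j, @h3 j, @h4 j⟩
  · intro h; exact ⟨fun j => (h j).1, fun j => (h j).2.1, fun j => (h j).2.2.1,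
      fun j => (h j).2.2.2⟩

lemma ok_ins {i : ι} {J K L M : Finset ι} (hJ : i ∉ J) (hK : i ∉ K) (hL : i ∉ L) (hM : i ∉ M)
    (x y z u : Bool) :
    Ok (ins i x J) (ins i y K) (ins i z L) (ins i u M) ↔ okB x y z u = true ∧ Ok J K L M := by
  rw [ok_iff, ok_iff]
  simp only [mem_ins]
  constructor
  · intro h
    refine ⟨?_, fun j => ?_⟩
    · have := h i
      revert this
      cases x <;> cases y <;> cases z <;> cases u <;> simp [okB, hJ, hK, hL, hM]
    · by_cases hj : j = i
      · subst hj; simp [hJ, hK, hL, hM]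
      · simpa [hj] using h j
  · rintro ⟨h1, h2⟩ j
    by_cases hj : j = i
    · subst hj
      revert h1
      cases x <;> cases y <;> cases z <;> cases u <;> simp [okB, hJ, hK, hL, hM]
    · simpa [hj] using h2 j

/-- The four-linear form. -/
def Phi (s : Finset ι) (a b c e : Finset ι → ℝ) : ℝ :=
  ∑ J ∈ s.powerset, ∑ K ∈ s.powerset, ∑ L ∈ s.powerset, ∑ M ∈ s.powerset,
    if Ok J K L M then a J * b K * c L * e M else 0

/-- The weighted square norm. -/
def NN (s : Finset ι) (a : Finset ι → ℝ) : ℝ := ∑ J ∈ s.powerset, 16 ^ J.card * a J ^ 2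

lemma NN_nonneg (s : Finset ι) (a : Finset ι → ℝ) : 0 ≤ NN s a :=
  Finset.sum_nonneg fun _ _ => by positivity

lemma NN_insert {i : ι} {s : Finset ι} (hi : i ∉ s) (a : Finset ι → ℝ) :
    NN (insert i s) a = NN s (fun J => a (ins i false J)) + 16 * NN s (fun J => a (ins i true J)) := by
  unfold NN
  rw [Finset.sum_powerset_insert hi, Finset.mul_sum]
  congr 1
  refine Finset.sum_congr rfl fun J hJ => ?_
  have : i ∉ J := fun h => hi (Finset.mem_powerset.1 hJ h)
  simp only [ins, if_true]
  rw [Finset.card_insert_of_notMem this, pow_succ]; ring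

lemma Phi_pattern {i : ι} {s : Finset ι} (hi : i ∉ s) (a b c e : Finset ι → ℝ) (x y z u : Bool) :
    (∑ J ∈ s.powerset, ∑ K ∈ s.powerset, ∑ L ∈ s.powerset, ∑ M ∈ s.powerset,
      if Ok (ins i x J) (ins i y K) (ins i z L) (ins i u M) then
        a (ins i x J) * b (ins i y K) * c (ins i z L) * e (ins i u M) else 0)
    = if okB x y z u then Phi s (fun J => a (ins i x J)) (fun J => b (ins i y J))
        (fun J => c (ins i z J)) (fun J => e (ins i u J)) else 0 := by
  have hn : ∀ J ∈ s.powerset, i ∉ J := fun J hJ h => hi (Finset.mem_powerset.1 hJ h)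
  split_ifs with h
  · unfold Phi
    refine Finset.sum_congr rfl fun J hJ => Finset.sum_congr rfl fun K hK =>
      Finset.sum_congr rfl fun L hL => Finset.sum_congr rfl fun M hM => ?_
    simp only [ok_ins (hn J hJ) (hn K hK) (hn L hL) (hn M hM), h, true_and]
  · refine Finset.sum_eq_zero fun J hJ => Finset.sum_eq_zero fun K hK =>
      Finset.sum_eq_zero fun L hL => Finset.sum_eq_zero fun M hM => ?_
    rw [if_neg]
    rw [ok_ins (hn J hJ) (hn K hK) (hn L hL) (hn M hM)]
    exact fun h' => h h'.1

lemma Phi_le (s : Finset ι) : ∀ a b c e : Finset ι → ℝ,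
    Phi s a b c e ≤ √(NN s a) * √(NN s b) * √(NN s c) * √(NN s e) := by
  induction s using Finset.induction_on with
  | empty =>
    intro a b c e
    simp only [Phi, NN, Finset.powerset_empty, Finset.sum_singleton, Finset.card_empty, pow_zero,
      one_mul, Real.sqrt_sq_eq_abs]
    have : Ok (∅ : Finset ι) ∅ ∅ ∅ := by simp [Ok]
    rw [if_pos this, ← abs_mul, ← abs_mul, ← abs_mul]
    exact le_abs_self _
  | insert i s hi ih =>
    intro a b c e
    have key : Phi (insert i s) a b c e = ∑ x : Bool, ∑ y : Bool, ∑ z : Bool, ∑ u : Bool,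
        (if okB x y z u then Phi s (fun J => a (ins i x J)) (fun J => b (ins i y J))
        (fun J => c (ins i z J)) (fun J => e (ins i u J)) else 0) := by
      simp_rw [← Phi_pattern hi]
      simp only [Fintype.sum_bool]
      unfold Phi
      simp only [Finset.sum_powerset_insert hi, Finset.sum_add_distrib, ins, if_true,
        Bool.false_eq_true, if_false]
      ring
    rw [key]
    simp only [Fintype.sum_bool, okB, if_true, Bool.false_eq_true, if_false]
    have h := fun x y z u => ih (fun J => a (ins i x J)) (fun J => b (ins i y J))
        (fun J => c (ins i z J)) (fun J => e (ins i u J))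
    have hoc := one_coord (√(NN s (fun J => a (ins i false J)))) (√(NN s (fun J => a (ins i true J))))
      (√(NN s (fun J => b (ins i false J)))) (√(NN s (fun J => b (ins i true J))))
      (√(NN s (fun J => c (ins i false J)))) (√(NN s (fun J => c (ins i true J))))
      (√(NN s (fun J => e (ins i false J)))) (√(NN s (fun J => e (ins i true J))))
    simp only [Real.sq_sqrt (NN_nonneg _ _), ← NN_insert hi] at hoc
    rw [Real.sqrt_mul' _ (NN_nonneg _ _), Real.sqrt_mul' _ (NN_nonneg _ _),
      Real.sqrt_mul' _ (NN_nonneg _ _)] at hoc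
    refine le_trans ?_ hoc
    have h0 := h false false false false
    have h1 := h true true false false
    have h2 := h true false true false
    have h3 := h true false false true
    have h4 := h false true true false
    have h5 := h false true false true
    have h6 := h false false true true
    have h7 := h true true true false
    have h8 := h true true false true
    have h9 := h true false true true
    have h10 := h false true true true
    have h11 := h true true true true
    linarith

lemma comb_bound [Fintype ι] (d : ℕ) (S : Finset (Finset ι)) (hS : ∀ J ∈ S, J.card = d)
    (σ : Finset ι → ℝ) :
    ∑ J ∈ S, ∑ K ∈ S, ∑ L ∈ S, ∑ M ∈ S, (if Ok J K L M then σ J * σ K * σ L * σ M else 0)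
      ≤ (16 ^ d * ∑ J ∈ S, σ J ^ 2) ^ 2 := by
  set a : Finset ι → ℝ := fun J => if J ∈ S then σ J else 0 with ha
  have h := Phi_le (Finset.univ : Finset ι) a a a a
  have hN : NN Finset.univ a = 16 ^ d * ∑ J ∈ S, σ J ^ 2 := by
    unfold NN
    rw [Finset.powerset_univ, Finset.mul_sum, ← Finset.sum_subset (Finset.subset_univ S)]
    · refine Finset.sum_congr rfl fun J hJ => ?_
      simp [ha, hJ, hS J hJ]
    · intro J _ hJ; simp [ha, hJ]
  have hR : √(NN Finset.univ a) * √(NN Finset.univ a) * √(NN Finset.univ a) * √(NN Finset.univ a)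
      = (16 ^ d * ∑ J ∈ S, σ J ^ 2) ^ 2 := by
    rw [Real.mul_self_sqrt (NN_nonneg _ _), mul_assoc, Real.mul_self_sqrt (NN_nonneg _ _), hN]
    ring
  rw [hR] at h
  refine le_trans (le_of_eq ?_) h
  unfold Phi
  rw [Finset.powerset_univ]
  have hs : ∀ f : Finset ι → ℝ, (∀ J, J ∉ S → f J = 0) → ∑ J ∈ S, f J = ∑ J, f J := by
    intro f hf
    exact Finset.sum_subset (Finset.subset_univ S) fun J _ hJ => hf J hJ
  rw [← hs]
  · refine Finset.sum_congr rfl fun J hJ => ?_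
    rw [← hs]
    · refine Finset.sum_congr rfl fun K hK => ?_
      rw [← hs]
      · refine Finset.sum_congr rfl fun L hL => ?_
        rw [← hs]
        · refine Finset.sum_congr rfl fun M hM => ?_
          simp [ha, hJ, hK, hL, hM]
        · intro M hM; simp [ha, hM]
      · intro L hL; simp [ha, hL]
    · intro K hK; simp [ha, hK]
  · intro J hJ; simp [ha, hJ]
end B
end DJ

namespace DJ

/-! ### Part C: conditional expectations given subfamilies of independent σ-algebras -/

set_option linter.unusedSectionVars false
set_option linter.overlappingInstances false

/-- σ-algebra generated by the coordinates in `K`. -/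
def FF {Ω ι : Type*} (𝓜 : ι → MeasurableSpace Ω) (K : Finset ι) : MeasurableSpace Ω :=
  ⨆ j ∈ K, 𝓜 j

section C
variable {Ω ι : Type*} {mΩ : MeasurableSpace Ω} {μ : Measure Ω} {𝓜 : ι → MeasurableSpace Ω}

lemma FF_le (hle : ∀ i, 𝓜 i ≤ mΩ) (K : Finset ι) : FF 𝓜 K ≤ mΩ := iSup₂_le fun i _ => hle i

lemma FF_mono {K L : Finset ι} (h : K ⊆ L) : FF 𝓜 K ≤ FF 𝓜 L :=
  iSup₂_le fun i hi => le_iSup₂_of_le i (h hi) le_rfl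

lemma FF_indep (hle : ∀ i, 𝓜 i ≤ mΩ) (hind : iIndep 𝓜 μ) {K L : Finset ι} (h : Disjoint K L) :
    Indep (FF 𝓜 K) (FF 𝓜 L) μ := by
  have := indep_iSup_of_disjoint hle hind (S := (K : Set ι)) (T := (L : Set ι))
    (by exact_mod_cast h)
  simpa [FF] using this

lemma setInt_prod [IsProbabilityMeasure μ] (hle : ∀ i, 𝓜 i ≤ mΩ) (hind : iIndep 𝓜 μ) {B C : Finset ι}
    (hBC : Disjoint B C) {h : Ω → ℝ} (hm : StronglyMeasurable[FF 𝓜 B] h) (hi : Integrable h μ)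
    {t1 t2 : Set Ω} (h1 : MeasurableSet[FF 𝓜 B] t1) (h2 : MeasurableSet[FF 𝓜 C] t2) :
    ∫ x in t1 ∩ t2, h x ∂μ = μ.real t2 * ∫ x in t1, h x ∂μ := by
  have hle1 := FF_le hle B
  have hle2 := FF_le hle C
  have hk : StronglyMeasurable[FF 𝓜 B] (t1.indicator h) := hm.indicator h1
  have hc := condExp_indep_eq hle1 hle2 hk (FF_indep hle hind hBC)
  have hki : Integrable (t1.indicator h) μ := hi.indicator (hle1 _ h1)
  have e1 : ∫ x in t2, t1.indicator h x ∂μ = ∫ x in t1 ∩ t2, h x ∂μ := by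
    rw [setIntegral_indicator (hle1 _ h1), Set.inter_comm]
  rw [← e1, ← setIntegral_condExp hle2 hki h2,
    setIntegral_congr_ae (g := fun _ => ∫ x, t1.indicator h x ∂μ) (hle2 _ h2)
      (hc.mono fun x hx _ => hx), setIntegral_const, integral_indicator (hle1 _ h1)]
  rfl

lemma condExp_inter [DecidableEq ι] [IsProbabilityMeasure μ] (hle : ∀ i, 𝓜 i ≤ mΩ) (hind : iIndep 𝓜 μ) (A B : Finset ι) {g : Ω → ℝ}
    (hm : StronglyMeasurable[FF 𝓜 B] g) (hi : Integrable g μ) :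
    μ[g|FF 𝓜 (A ∩ B)] =ᵐ[μ] μ[g|FF 𝓜 A] := by
  have hAB := FF_le hle (A ∩ B)
  have hA := FF_le hle A
  refine ae_eq_condExp_of_forall_setIntegral_eq hA hi
    (fun s _ _ => integrable_condExp.integrableOn) ?_
    (stronglyMeasurable_condExp.mono (FF_mono Finset.inter_subset_left)).aestronglyMeasurable
  have hgen : FF 𝓜 A = MeasurableSpace.generateFrom
      (piiUnionInter (fun n => { s | MeasurableSet[𝓜 n] s }) (A : Set ι)) := by
    rw [generateFrom_piiUnionInter_measurableSet 𝓜]; simp [FF]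
  have hpi : IsPiSystem (piiUnionInter (fun n => { s | MeasurableSet[𝓜 n] s }) (A : Set ι)) :=
    isPiSystem_piiUnionInter _ (fun i => @MeasurableSpace.isPiSystem_measurableSet _ (𝓜 i)) _
  have hmain : ∀ s, MeasurableSet[FF 𝓜 A] s →
      ∫ x in s, (μ[g|FF 𝓜 (A ∩ B)]) x ∂μ = ∫ x in s, g x ∂μ := by
    refine @MeasurableSpace.induction_on_inter Ω (FF 𝓜 A) (fun s _ =>
      ∫ x in s, (μ[g|FF 𝓜 (A ∩ B)]) x ∂μ = ∫ x in s, g x ∂μ) _ hgen hpi ?_ ?_ ?_ ?_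
    · simp
    · rintro t ⟨p, hp, f, hf, rfl⟩
      have hp' : p ⊆ A := by exact_mod_cast hp
      set t1 : Set Ω := ⋂ x ∈ p ∩ B, f x
      set t2 : Set Ω := ⋂ x ∈ p \ B, f x
      have ht : (⋂ x ∈ p, f x) = t1 ∩ t2 := by
        ext ω
        simp only [t1, t2, Set.mem_iInter, Set.mem_inter_iff, Finset.mem_inter, Finset.mem_sdiff]
        constructor
        · intro h; exact ⟨fun i hi => h i hi.1, fun i hi => h i hi.1⟩
        · rintro ⟨h1, h2⟩ i hi
          by_cases hb : i ∈ B
          · exact h1 i ⟨hi, hb⟩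
          · exact h2 i ⟨hi, hb⟩
      have h1 : MeasurableSet[FF 𝓜 (A ∩ B)] t1 := by
        refine Finset.measurableSet_biInter _ fun i hi => ?_
        have hi' : i ∈ A ∩ B := by
          simp only [Finset.mem_inter] at hi ⊢; exact ⟨hp' hi.1, hi.2⟩
        exact (le_iSup₂_of_le (f := fun j (_ : j ∈ A ∩ B) => 𝓜 j) i hi' le_rfl) _
          (hf i (Finset.mem_inter.1 hi).1)
      have h2 : MeasurableSet[FF 𝓜 (A \ B)] t2 := by
        refine Finset.measurableSet_biInter _ fun i hi => ?_
        have hi' : i ∈ A \ B := by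
          simp only [Finset.mem_sdiff] at hi ⊢; exact ⟨hp' hi.1, hi.2⟩
        exact (le_iSup₂_of_le (f := fun j (_ : j ∈ A \ B) => 𝓜 j) i hi' le_rfl) _
          (hf i (Finset.mem_sdiff.1 hi).1)
      have hdis : Disjoint B (A \ B) := Finset.disjoint_sdiff
      have h1B : MeasurableSet[FF 𝓜 B] t1 := FF_mono Finset.inter_subset_right _ h1
      rw [ht, setInt_prod hle hind hdis hm hi h1B h2,
        setInt_prod hle hind hdis
          (stronglyMeasurable_condExp.mono (FF_mono Finset.inter_subset_right))
          integrable_condExp h1B h2, setIntegral_condExp hAB hi h1]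
    · intro t ht h
      have ht' := hA _ ht
      have e1 := integral_add_compl ht' hi
      have e2 := integral_add_compl ht' (integrable_condExp (m := FF 𝓜 (A ∩ B)) (f := g) (μ := μ))
      rw [integral_condExp hAB] at e2
      linarith
    · intro f hd hf h
      rw [integral_iUnion (fun i => hA _ (hf i)) hd integrable_condExp.integrableOn,
        integral_iUnion (fun i => hA _ (hf i)) hd hi.integrableOn]
      exact tsum_congr h
  exact fun s hs _ => hmain s hs

end C

section C1
variable {Ω : Type*} {m m' : MeasurableSpace Ω} {mΩ : MeasurableSpace Ω}

/-- conditional expectation as an operator on `L²`. -/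
noncomputable def TT (μ : Measure Ω) (hm : m ≤ mΩ) :
    Lp ℝ 2 μ →ₗ[ℝ] Lp ℝ 2 μ :=
  (lpMeas ℝ ℝ m 2 μ).subtype ∘ₗ (condExpL2 ℝ ℝ hm).toLinearMap

variable {μ : Measure Ω}
lemma TT_mem (hm : m ≤ mΩ) (f : Lp ℝ 2 μ) :
    TT μ hm f ∈ lpMeas ℝ ℝ m 2 μ := by
  simp [TT]

lemma TT_of_mem (hm : m ≤ mΩ) (f : Lp ℝ 2 μ)
    (hf : f ∈ lpMeas ℝ ℝ m 2 μ) : TT μ hm f = f := by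
  haveI : Fact (m ≤ mΩ) := ⟨hm⟩
  simp only [TT, LinearMap.comp_apply, condExpL2]
  exact Submodule.starProjection_eq_self_iff.2 hf

lemma TT_sym (hm : m ≤ mΩ) (f g : Lp ℝ 2 μ) :
    inner ℝ (TT μ hm f) g = inner ℝ f (TT μ hm g) :=
  inner_condExpL2_left_eq_right hm

lemma TT_nest (hm : m ≤ mΩ) (hm' : m' ≤ mΩ) (h : m ≤ m')
    (f : Lp ℝ 2 μ) : TT μ hm (TT μ hm' f) = TT μ hm f := by
  refine ext_inner_right ℝ fun g => ?_
  rw [TT_sym, TT_sym, TT_sym, TT_of_mem hm' (TT μ hm g)]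
  have := TT_mem hm g
  rw [mem_lpMeas_iff_aestronglyMeasurable] at this ⊢
  exact this.mono h

lemma TT_ae [IsProbabilityMeasure μ] (hm : m ≤ mΩ) {f : Ω → ℝ} (hf : MemLp f 2 μ) :
    TT μ hm (hf.toLp f) =ᵐ[μ] μ[f|m] :=
  hf.condExpL2_ae_eq_condExp hm (𝕜 := ℝ)

end C1

section C2
variable {Ω ι : Type*} {mΩ : MeasurableSpace Ω} {μ : Measure Ω} {𝓜 : ι → MeasurableSpace Ω}

lemma TT_congr (hle : ∀ i, 𝓜 i ≤ mΩ) {A B : Finset ι} (h : A = B) (f : Lp ℝ 2 μ) :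
    TT μ (FF_le hle A) f = TT μ (FF_le hle B) f := by subst h; rfl

lemma TT_mem_inter [DecidableEq ι] [IsProbabilityMeasure μ] (hle : ∀ i, 𝓜 i ≤ mΩ) (hind : iIndep 𝓜 μ) (A B : Finset ι)
    (g : Lp ℝ 2 μ) (hg : g ∈ lpMeas ℝ ℝ (FF 𝓜 B) 2 μ) :
    TT μ (FF_le hle A) g ∈ lpMeas ℝ ℝ (FF 𝓜 (A ∩ B)) 2 μ := by
  rw [mem_lpMeas_iff_aestronglyMeasurable] at hg ⊢
  obtain ⟨g', hg'm, hgg'⟩ := hg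
  have hL : MemLp g' 2 μ := (memLp_congr_ae hgg').1 (Lp.memLp g)
  have e : g = hL.toLp g' := by
    rw [← Lp.toLp_coeFn g (Lp.memLp g)]; exact MemLp.toLp_congr _ _ hgg'
  rw [e]
  have h1 := TT_ae (FF_le hle A) hL
  have h2 := condExp_inter hle hind A B hg'm (hL.integrable (by norm_num))
  exact ⟨_, stronglyMeasurable_condExp, h1.trans h2.symm⟩

lemma TT_inter [DecidableEq ι] [IsProbabilityMeasure μ] (hle : ∀ i, 𝓜 i ≤ mΩ) (hind : iIndep 𝓜 μ) (A B : Finset ι) (f : Lp ℝ 2 μ) :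
    TT μ (FF_le hle A) (TT μ (FF_le hle B) f) = TT μ (FF_le hle (A ∩ B)) f := by
  have h1 := TT_mem_inter hle hind A B _ (TT_mem (FF_le hle B) f)
  rw [← TT_of_mem (FF_le hle (A ∩ B)) _ h1, TT_nest _ _ (FF_mono Finset.inter_subset_left),
    TT_nest _ _ (FF_mono Finset.inter_subset_right)]

/-- `P i = 1 - E[· | all coordinates but i]`. -/
noncomputable def PP [Fintype ι] [DecidableEq ι] (μ : Measure Ω) (hle : ∀ i, 𝓜 i ≤ mΩ) (i : ι) :
    Lp ℝ 2 μ →ₗ[ℝ] Lp ℝ 2 μ :=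
  LinearMap.id - TT μ (FF_le hle (Finset.univ.erase i))

lemma PP_apply [Fintype ι] [DecidableEq ι] (hle : ∀ i, 𝓜 i ≤ mΩ) (i : ι) (f : Lp ℝ 2 μ) :
    PP μ hle i f = f - TT μ (FF_le hle (Finset.univ.erase i)) f := rfl

lemma PP_sym [Fintype ι] [DecidableEq ι] (hle : ∀ i, 𝓜 i ≤ mΩ) (i : ι) (f g : Lp ℝ 2 μ) :
    inner ℝ (PP μ hle i f) g = inner ℝ f (PP μ hle i g) := by
  rw [PP_apply, PP_apply, inner_sub_left, inner_sub_right, TT_sym]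

lemma PP_id [Fintype ι] [DecidableEq ι] (hle : ∀ i, 𝓜 i ≤ mΩ) (i : ι) (f : Lp ℝ 2 μ) :
    PP μ hle i (PP μ hle i f) = PP μ hle i f := by
  simp only [PP_apply, map_sub]
  rw [TT_nest _ _ le_rfl]; simp

lemma PP_comm [Fintype ι] [DecidableEq ι] [IsProbabilityMeasure μ] (hle : ∀ i, 𝓜 i ≤ mΩ)
    (hind : iIndep 𝓜 μ) (i j : ι) (f : Lp ℝ 2 μ) :
    PP μ hle i (PP μ hle j f) = PP μ hle j (PP μ hle i f) := by
  simp only [PP_apply, map_sub]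
  rw [TT_inter hle hind, TT_inter hle hind]
  rw [TT_congr hle (Finset.inter_comm (Finset.univ.erase j) (Finset.univ.erase i))]
  abel

lemma PP_of_mem [Fintype ι] [DecidableEq ι] (hle : ∀ i, 𝓜 i ≤ mΩ) (i : ι) (f : Lp ℝ 2 μ)
    (M : Finset ι) (hi : i ∉ M) (hf : f ∈ lpMeas ℝ ℝ (FF 𝓜 M) 2 μ) : PP μ hle i f = 0 := by
  rw [PP_apply, TT_of_mem, sub_self]
  rw [mem_lpMeas_iff_aestronglyMeasurable] at hf ⊢
  refine hf.mono (FF_mono fun j hj => ?_)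
  simp only [Finset.mem_erase, Finset.mem_univ, and_true]
  rintro rfl; exact hi hj

lemma deg_of_mem [Fintype ι] [DecidableEq ι] [IsProbabilityMeasure μ] (hle : ∀ i, 𝓜 i ≤ mΩ)
    (hind : iIndep 𝓜 μ) (M : Finset ι) (k : ℕ) : ∀ (s : Finset ι) (f : Lp ℝ 2 μ),
    f ∈ lpMeas ℝ ℝ (FF 𝓜 M) 2 μ → (M ∩ s).card ≤ k → Deg (PP μ hle) k s f := by
  induction k with
  | zero =>
    intro s f hf hc i hi
    refine PP_of_mem hle i f M ?_ hf
    intro hiM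
    have : M ∩ s = ∅ := by simpa using hc
    have h2 : i ∈ M ∩ s := by simp [hiM, hi]
    simp [this] at h2
  | succ k ih =>
    intro s f hf hc i hi
    by_cases hiM : i ∈ M
    · refine ih _ _ ?_ ?_
      · rw [PP_apply]
        refine Submodule.sub_mem _ hf ?_
        have := TT_mem_inter hle hind (Finset.univ.erase i) M f hf
        rw [mem_lpMeas_iff_aestronglyMeasurable] at this ⊢
        exact this.mono (FF_mono Finset.inter_subset_right)
      · have : M ∩ s.erase i = (M ∩ s).erase i := by
          ext j; simp only [Finset.mem_inter, Finset.mem_erase]; tauto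
        rw [this, Finset.card_erase_of_mem (by simp [hiM, hi])]
        omega
    · rw [PP_of_mem hle i f M hiM hf]; exact deg_zero _ _ _
end C2
end DJ

namespace DJ

/-! ### Part D: the degenerate U-statistic for a fixed sample size -/

lemma hilbert_stein {ι H : Type*} [Fintype ι] [NormedAddCommGroup H] [InnerProductSpace ℝ H]
    (P : ι → H →ₗ[ℝ] H) (hsym : ∀ i x y, inner ℝ (P i x) y = inner ℝ x (P i y))
    (hid : ∀ i x, P i (P i x) = P i x) (d : ℕ) (hd : 1 ≤ d) (B : ℝ) (hB : 0 ≤ B)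
    (w ff F : H) (δ e a ffi Fi : ι → H)
    (h1 : ∑ i, δ i = (d:ℝ) • w) (h2 : ∀ i, inner ℝ (δ i) (ffi i) = (0:ℝ))
    (h3 : ∀ i, inner ℝ (δ i) (ff - ffi i) = inner ℝ F (a i) + inner ℝ (δ i) (e i))
    (h4 : ∀ i, ‖e i‖ ≤ B * ‖a i‖) (h5 : ∀ i, ‖F - Fi i‖ ≤ B * ‖δ i‖) (h6 : ∀ i, P i (Fi i) = 0) :
    |inner ℝ w ff - inner ℝ F ((2 * d : ℝ)⁻¹ • (∑ i, ((2:ℝ) • a i - P i (a i))))|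
      ≤ 2 * B * ∑ i, ‖δ i‖ * ‖a i‖ := by
  have hd0 : (1:ℝ) ≤ d := by exact_mod_cast hd
  have hPn : ∀ i x, ‖P i x‖ ≤ ‖x‖ := by
    intro i x
    have e1 : ‖P i x‖ ^ 2 ≤ ‖x‖ * ‖P i x‖ := by
      rw [← real_inner_self_eq_norm_sq, hsym, hid]
      exact real_inner_le_norm _ _
    by_contra hc
    push Not at hc
    nlinarith [norm_nonneg x]
  have hA : d * inner ℝ w ff = ∑ i, (inner ℝ F (a i) + inner ℝ (δ i) (e i)) := by
    have : d * inner ℝ w ff = ∑ i, inner ℝ (δ i) ff := by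
      rw [← sum_inner, h1, inner_smul_left]; simp
    rw [this]
    refine Finset.sum_congr rfl fun i _ => ?_
    rw [← h3 i, inner_sub_right, h2, sub_zero]
  have hBB : d * inner ℝ F ((2 * d : ℝ)⁻¹ • (∑ i, ((2:ℝ) • a i - P i (a i))))
      = ∑ i, (inner ℝ F (a i) - 2⁻¹ * inner ℝ F (P i (a i))) := by
    rw [inner_smul_right, inner_sum, ← mul_assoc, Finset.mul_sum]
    refine Finset.sum_congr rfl fun i _ => ?_
    rw [inner_sub_right, inner_smul_right]
    field_simp
  have hC : d * (inner ℝ w ff - inner ℝ F ((2 * d : ℝ)⁻¹ • (∑ i, ((2:ℝ) • a i - P i (a i)))))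
      = ∑ i, (inner ℝ (δ i) (e i) + 2⁻¹ * inner ℝ F (P i (a i))) := by
    rw [mul_sub, hA, hBB, ← Finset.sum_sub_distrib]
    exact Finset.sum_congr rfl fun i _ => by ring
  have hD : |d * (inner ℝ w ff - inner ℝ F ((2 * d : ℝ)⁻¹ • (∑ i, ((2:ℝ) • a i - P i (a i)))))|
      ≤ 2 * B * ∑ i, ‖δ i‖ * ‖a i‖ := by
    rw [hC, Finset.mul_sum]
    refine (Finset.abs_sum_le_sum_abs _ _).trans (Finset.sum_le_sum fun i _ => ?_)
    have e1 : |inner ℝ (δ i) (e i)| ≤ B * (‖δ i‖ * ‖a i‖) := by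
      refine (abs_real_inner_le_norm _ _).trans ?_
      calc ‖δ i‖ * ‖e i‖ ≤ ‖δ i‖ * (B * ‖a i‖) := by gcongr; exact h4 i
        _ = _ := by ring
    have e2 : |inner ℝ F (P i (a i))| ≤ B * (‖δ i‖ * ‖a i‖) := by
      have : inner ℝ F (P i (a i)) = inner ℝ (F - Fi i) (P i (a i)) := by
        rw [inner_sub_left, ← hsym i (Fi i), h6, inner_zero_left, sub_zero]
      rw [this]
      refine (abs_real_inner_le_norm _ _).trans ?_
      calc ‖F - Fi i‖ * ‖P i (a i)‖ ≤ (B * ‖δ i‖) * ‖a i‖ := by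
            gcongr
            · exact h5 i
            · exact hPn _ _
        _ = _ := by ring
    refine (abs_add_le _ _).trans ?_
    rw [abs_mul, abs_of_pos (by norm_num : (0:ℝ) < 2⁻¹)]
    have : 0 ≤ B * (‖δ i‖ * ‖a i‖) := by positivity
    linarith
  rw [abs_mul, abs_of_nonneg (by linarith)] at hD
  refine le_trans ?_ hD
  exact le_mul_of_one_le_left (abs_nonneg _) hd0

section D
variable {Ω : Type*} {mΩ : MeasurableSpace Ω} {μ : Measure Ω}

instance holder442 : ENNReal.HolderTriple 4 4 2 where
  inv_add_inv_eq_inv := by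
    rw [← two_mul, show (4:ENNReal) = 2 * 2 by norm_num,
      ENNReal.mul_inv (by simp) (by simp), ← mul_assoc, ENNReal.mul_inv_cancel (by simp) (by simp),
      one_mul]

lemma mul44 {f g : Ω → ℝ} (hf : MemLp f 4 μ) (hg : MemLp g 4 μ) :
    MemLp (fun ω => f ω * g ω) 2 μ := hg.mul hf

lemma sq4 {f : Ω → ℝ} (hf : MemLp f 4 μ) : MemLp (fun ω => f ω ^ 2) 2 μ := by
  simpa [pow_two] using mul44 hf hf

lemma int22 {f g : Ω → ℝ} (hf : MemLp f 2 μ) (hg : MemLp g 2 μ) :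
    Integrable (fun ω => f ω * g ω) μ := hf.integrable_mul hg

lemma int4 {f : Ω → ℝ} (hf : MemLp f 4 μ) : Integrable (fun ω => f ω ^ 4) μ := by
  refine (int22 (sq4 hf) (sq4 hf)).congr (Eventually.of_forall fun ω => ?_)
  simp only; ring

lemma inner_toLp {f g : Ω → ℝ} (hf : MemLp f 2 μ) (hg : MemLp g 2 μ) :
    inner ℝ (hf.toLp f) (hg.toLp g) = ∫ ω, f ω * g ω ∂μ := by
  rw [L2.inner_def]
  refine integral_congr_ae ?_
  filter_upwards [hf.coeFn_toLp, hg.coeFn_toLp] with ω h1 h2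
  rw [h1, h2]; simp [mul_comm]

lemma toLp_sum {α : Type*} (t : Finset α) (f : α → Ω → ℝ) (hf : ∀ x, MemLp (f x) 2 μ)
    (h : MemLp (fun ω => ∑ x ∈ t, f x ω) 2 μ) :
    h.toLp _ = ∑ x ∈ t, (hf x).toLp (f x) := by
  classical
  induction t using Finset.induction_on with
  | empty =>
    simp only [Finset.sum_empty]
    exact (MemLp.toLp_congr h MemLp.zero' (by simp)).trans (MemLp.toLp_zero _)
  | insert x t hx ih =>
    have h' : MemLp (fun ω => ∑ y ∈ t, f y ω) 2 μ := memLp_finsetSum t fun y _ => hf y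
    rw [Finset.sum_insert hx, ← ih h', ← MemLp.toLp_add]
    exact MemLp.toLp_congr _ _ (Eventually.of_forall fun ω => by simp [Finset.sum_insert hx])

lemma norm_toLp_le {f g : Ω → ℝ} (hf : MemLp f 2 μ) (hg : MemLp g 2 μ) (B : ℝ)
    (h : ∀ ω, |f ω| ≤ B * |g ω|) : ‖hf.toLp f‖ ≤ B * ‖hg.toLp g‖ := by
  refine Lp.norm_le_mul_norm_of_ae_le_mul ?_
  filter_upwards [hf.coeFn_toLp, hg.coeFn_toLp] with ω h1 h2
  rw [h1, h2]; exact h ω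

end D

/-- The hypotheses on the summands of a degenerate U-statistic of order `d`. -/
structure Setup {Ω ι : Type*} [Fintype ι] [DecidableEq ι] {mΩ : MeasurableSpace Ω}
    (μ : Measure Ω) (𝓜 : ι → MeasurableSpace Ω) (d : ℕ) (WJ : Finset ι → Ω → ℝ) : Prop where
  hle : ∀ i, 𝓜 i ≤ mΩ
  hind : iIndep 𝓜 μ
  hmeas : ∀ J ∈ Finset.powersetCard d (Finset.univ : Finset ι), Measurable[FF 𝓜 J] (WJ J)
  hL4 : ∀ J ∈ Finset.powersetCard d (Finset.univ : Finset ι), MemLp (WJ J) 4 μ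
  hdeg : ∀ J ∈ Finset.powersetCard d (Finset.univ : Finset ι), ∀ K : Finset ι, ¬ J ⊆ K →
    μ[WJ J|FF 𝓜 K] =ᵐ[μ] 0

section D2
variable {Ω ι : Type*} [Fintype ι] [DecidableEq ι] {mΩ : MeasurableSpace Ω}
    {μ : Measure Ω} [IsProbabilityMeasure μ] {𝓜 : ι → MeasurableSpace Ω} {d : ℕ}
    {WJ : Finset ι → Ω → ℝ}

lemma Setup.condExp_zero (h : Setup μ 𝓜 d WJ) {J : Finset ι}
    (hJ : J ∈ Finset.powersetCard d (Finset.univ : Finset ι)) {i : ι} (hi : i ∈ J) :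
    μ[WJ J|FF 𝓜 (Finset.univ.erase i)] =ᵐ[μ] 0 :=
  h.hdeg J hJ _ fun hs => by simpa using hs hi

lemma Setup.ortho (h : Setup μ 𝓜 d WJ) {J : Finset ι}
    (hJ : J ∈ Finset.powersetCard d (Finset.univ : Finset ι)) {i : ι} (hi : i ∈ J) {g : Ω → ℝ}
    (hg : StronglyMeasurable[FF 𝓜 (Finset.univ.erase i)] g)
    (hIntg : Integrable (fun ω => WJ J ω * g ω) μ) : ∫ ω, WJ J ω * g ω ∂μ = 0 := by
  have hm := FF_le h.hle (Finset.univ.erase i)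
  have hW : Integrable (WJ J) μ := (h.hL4 J hJ).integrable (by norm_num)
  have e := condExp_mul_of_stronglyMeasurable_right (μ := μ) hg hIntg hW
  have e2 := h.condExp_zero hJ hi
  rw [← integral_condExp hm]
  have : μ[fun ω => WJ J ω * g ω|FF 𝓜 (Finset.univ.erase i)] =ᵐ[μ] 0 := by
    refine EventuallyEq.trans e ?_
    filter_upwards [e2] with ω hω
    simp [hω]
  rw [integral_congr_ae this]; simp

lemma Setup.sm (h : Setup μ 𝓜 d WJ) {J : Finset ι}
    (hJ : J ∈ Finset.powersetCard d (Finset.univ : Finset ι)) {K : Finset ι} (hK : J ⊆ K) :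
    StronglyMeasurable[FF 𝓜 K] (WJ J) :=
  ((h.hmeas J hJ).mono (FF_mono hK) le_rfl).stronglyMeasurable

lemma sub_erase {J : Finset ι} {i : ι} (hi : i ∉ J) : J ⊆ Finset.univ.erase i := by
  intro j hj
  simp only [Finset.mem_erase, Finset.mem_univ, and_true]
  rintro rfl; exact hi hj

lemma Setup.ortho2 (h : Setup μ 𝓜 d WJ) {J K : Finset ι}
    (hJ : J ∈ Finset.powersetCard d (Finset.univ : Finset ι))
    (hK : K ∈ Finset.powersetCard d (Finset.univ : Finset ι)) (hne : J ≠ K) :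
    ∫ ω, WJ J ω * WJ K ω ∂μ = 0 := by
  have hns : ¬ J ⊆ K := by
    intro hs
    refine hne (Finset.eq_of_subset_of_card_le hs ?_)
    rw [(Finset.mem_powersetCard.1 hJ).2, (Finset.mem_powersetCard.1 hK).2]
  obtain ⟨i, hiJ, hiK⟩ := Finset.not_subset.1 hns
  exact h.ortho hJ hiJ (h.sm hK (sub_erase hiK))
    (int22 ((h.hL4 J hJ).mono_exponent (by norm_num)) ((h.hL4 K hK).mono_exponent (by norm_num)))

lemma Setup.mean_zero (h : Setup μ 𝓜 d WJ) (hd : 1 ≤ d) {J : Finset ι}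
    (hJ : J ∈ Finset.powersetCard d (Finset.univ : Finset ι)) : ∫ ω, WJ J ω ∂μ = 0 := by
  have hc : 0 < J.card := by rw [(Finset.mem_powersetCard.1 hJ).2]; omega
  obtain ⟨i, hi⟩ := Finset.card_pos.1 hc
  have := h.ortho hJ hi (g := fun _ => 1) stronglyMeasurable_const
    (by simpa using (h.hL4 J hJ).integrable (by norm_num))
  simpa using this

lemma Setup.var_sum (h : Setup μ 𝓜 d WJ) (T : Finset (Finset ι))
    (hT : T ⊆ Finset.powersetCard d (Finset.univ : Finset ι)) :
    ∫ ω, (∑ J ∈ T, WJ J ω) ^ 2 ∂μ = ∑ J ∈ T, ∫ ω, WJ J ω ^ 2 ∂μ := by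
  have h2 : ∀ J ∈ T, MemLp (WJ J) 2 μ := fun J hJ => (h.hL4 J (hT hJ)).mono_exponent (by norm_num)
  have e : ∀ ω, (∑ J ∈ T, WJ J ω) ^ 2 = ∑ J ∈ T, ∑ K ∈ T, WJ J ω * WJ K ω := by
    intro ω; rw [pow_two, Finset.sum_mul_sum]
  simp_rw [e]
  rw [integral_finsetSum _ fun J hJ => integrable_finsetSum _ fun K hK => int22 (h2 J hJ) (h2 K hK)]
  refine Finset.sum_congr rfl fun J hJ => ?_
  rw [integral_finsetSum _ fun K hK => int22 (h2 J hJ) (h2 K hK)]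
  rw [Finset.sum_eq_single_of_mem J hJ fun K hK hne => h.ortho2 (hT hJ) (hT hK) hne.symm]
  simp_rw [pow_two]

lemma prod4_bound {f1 f2 f3 f4 : Ω → ℝ} (h1 : MemLp f1 4 μ) (h2 : MemLp f2 4 μ)
    (h3 : MemLp f3 4 μ) (h4 : MemLp f4 4 μ) {s1 s2 s3 s4 D : ℝ} (p1 : 0 < s1) (p2 : 0 < s2)
    (p3 : 0 < s3) (p4 : 0 < s4) (b1 : ∫ ω, f1 ω ^ 4 ∂μ ≤ D * s1 ^ 4)
    (b2 : ∫ ω, f2 ω ^ 4 ∂μ ≤ D * s2 ^ 4) (b3 : ∫ ω, f3 ω ^ 4 ∂μ ≤ D * s3 ^ 4)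
    (b4 : ∫ ω, f4 ω ^ 4 ∂μ ≤ D * s4 ^ 4) :
    ∫ ω, f1 ω * f2 ω * f3 ω * f4 ω ∂μ ≤ D * (s1 * s2 * s3 * s4) := by
  have amgm : ∀ x y z u : ℝ, x * y * z * u ≤ 4⁻¹ * (x^4 + y^4 + z^4 + u^4) := by
    intro x y z u
    nlinarith [sq_nonneg (x*y - z*u), sq_nonneg (x^2 - y^2), sq_nonneg (z^2-u^2)]
  set Q := s1 * s2 * s3 * s4 with hQ
  have hQ0 : 0 < Q := by positivity
  have hpt : ∀ ω, f1 ω * f2 ω * f3 ω * f4 ω ≤ Q * (4⁻¹ * ((s1^4)⁻¹ * f1 ω ^ 4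
      + (s2^4)⁻¹ * f2 ω ^ 4 + (s3^4)⁻¹ * f3 ω ^ 4 + (s4^4)⁻¹ * f4 ω ^ 4)) := by
    intro ω
    have := mul_le_mul_of_nonneg_left (amgm (f1 ω / s1) (f2 ω / s2) (f3 ω / s3) (f4 ω / s4)) hQ0.le
    calc _ = Q * (f1 ω / s1 * (f2 ω / s2) * (f3 ω / s3) * (f4 ω / s4)) := by
          rw [hQ]; field_simp
      _ ≤ _ := this
      _ = _ := by simp only [div_pow]; ring
  have hi : Integrable (fun ω => f1 ω * f2 ω * f3 ω * f4 ω) μ := by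
    refine (int22 (mul44 h1 h2) (mul44 h3 h4)).congr (Eventually.of_forall fun ω => ?_)
    simp only; ring
  have i1 := (int4 h1).const_mul (s1^4)⁻¹
  have i2 := (int4 h2).const_mul (s2^4)⁻¹
  have i3 := (int4 h3).const_mul (s3^4)⁻¹
  have i4 := (int4 h4).const_mul (s4^4)⁻¹
  refine (integral_mono hi ((((i1.add i2).add i3).add i4).const_mul 4⁻¹ |>.const_mul Q) hpt).trans ?_
  have e : ∫ ω, Q * (4⁻¹ * ((s1^4)⁻¹ * f1 ω ^ 4
      + (s2^4)⁻¹ * f2 ω ^ 4 + (s3^4)⁻¹ * f3 ω ^ 4 + (s4^4)⁻¹ * f4 ω ^ 4)) ∂μ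
      = Q * (4⁻¹ * ((s1^4)⁻¹ * ∫ ω, f1 ω ^ 4 ∂μ
      + (s2^4)⁻¹ * ∫ ω, f2 ω ^ 4 ∂μ + (s3^4)⁻¹ * ∫ ω, f3 ω ^ 4 ∂μ
      + (s4^4)⁻¹ * ∫ ω, f4 ω ^ 4 ∂μ)) := by
    have i12 : Integrable (fun ω => (s1^4)⁻¹ * f1 ω ^ 4 + (s2^4)⁻¹ * f2 ω ^ 4) μ := i1.add i2
    have i123 : Integrable (fun ω => (s1^4)⁻¹ * f1 ω ^ 4 + (s2^4)⁻¹ * f2 ω ^ 4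
      + (s3^4)⁻¹ * f3 ω ^ 4) μ := i12.add i3
    rw [integral_const_mul, integral_const_mul, integral_add i123 i4,
      integral_add i12 i3, integral_add i1 i2]
    simp only [integral_const_mul]
  refine le_of_eq_of_le e ?_
  have g : ∀ s I : ℝ, 0 < s → I ≤ D * s^4 → (s^4)⁻¹ * I ≤ D := by
    intro s I hs hI
    rw [inv_mul_le_iff₀ (by positivity)]; linarith
  have g1 := g _ _ p1 b1
  have g2 := g _ _ p2 b2
  have g3 := g _ _ p3 b3
  have g4 := g _ _ p4 b4
  rw [mul_comm D]
  gcongr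
  linarith

lemma Setup.fourth (h : Setup μ 𝓜 d WJ) (T : Finset (Finset ι))
    (hT : T ⊆ Finset.powersetCard d (Finset.univ : Finset ι)) (D : ℝ) (hD : 0 ≤ D)
    (hb : ∀ J ∈ T, ∫ ω, WJ J ω ^ 4 ∂μ ≤ D * (∫ ω, WJ J ω ^ 2 ∂μ) ^ 2) :
    ∫ ω, (∑ J ∈ T, WJ J ω) ^ 4 ∂μ ≤ D * (16 ^ d * ∑ J ∈ T, ∫ ω, WJ J ω ^ 2 ∂μ) ^ 2 := by
  have h4 : ∀ J ∈ T, MemLp (WJ J) 4 μ := fun J hJ => h.hL4 J (hT hJ)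
  have e : ∀ ω, (∑ J ∈ T, WJ J ω) ^ 4
      = ∑ J ∈ T, ∑ K ∈ T, ∑ L ∈ T, ∑ M ∈ T, WJ J ω * WJ K ω * WJ L ω * WJ M ω := by
    intro ω
    rw [show (∑ J ∈ T, WJ J ω) ^ 4 = (∑ J ∈ T, WJ J ω) * (∑ J ∈ T, WJ J ω) *
      (∑ J ∈ T, WJ J ω) * (∑ J ∈ T, WJ J ω) by ring]
    simp only [Finset.sum_mul, Finset.mul_sum]
    rw [Finset.sum_comm]
    refine Finset.sum_congr rfl fun J _ => ?_
    rw [Finset.sum_comm]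
    refine (Finset.sum_congr rfl fun K _ => Finset.sum_comm).trans ?_
    rw [Finset.sum_comm]
    refine Finset.sum_congr rfl fun K _ => ?_
    refine Finset.sum_congr rfl fun L _ => ?_
    refine Finset.sum_congr rfl fun M _ => ?_
    ring
  have hi : ∀ J ∈ T, ∀ K ∈ T, ∀ L ∈ T, ∀ M ∈ T,
      Integrable (fun ω => WJ J ω * WJ K ω * WJ L ω * WJ M ω) μ := by
    intro J hJ K hK L hL M hM
    refine (int22 (mul44 (h4 J hJ) (h4 K hK)) (mul44 (h4 L hL) (h4 M hM))).congr
      (Eventually.of_forall fun ω => ?_)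
    simp only; ring
  simp_rw [e]
  rw [integral_finsetSum _ fun J hJ => integrable_finsetSum _ fun K hK =>
    integrable_finsetSum _ fun L hL => integrable_finsetSum _ fun M hM => hi J hJ K hK L hL M hM]
  set σ : Finset ι → ℝ := fun J => √(∫ ω, WJ J ω ^ 2 ∂μ) with hσ
  have hσ2 : ∀ J, σ J ^ 2 = ∫ ω, WJ J ω ^ 2 ∂μ := fun J =>
    Real.sq_sqrt (integral_nonneg fun ω => by positivity)
  have hσ0 : ∀ J ∈ T, σ J = 0 → WJ J =ᵐ[μ] 0 := by
    intro J hJ h0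
    have : ∫ ω, WJ J ω ^ 2 ∂μ = 0 := by rw [← hσ2, h0]; norm_num
    rw [integral_eq_zero_iff_of_nonneg (fun ω => by positivity)
      ((h4 J hJ).mono_exponent (by norm_num : (2:ENNReal) ≤ 4)).integrable_sq] at this
    filter_upwards [this] with ω hω
    simpa using hω
  have hterm : ∀ J ∈ T, ∀ K ∈ T, ∀ L ∈ T, ∀ M ∈ T,
      ∫ ω, WJ J ω * WJ K ω * WJ L ω * WJ M ω ∂μ
        ≤ D * (if Ok J K L M then σ J * σ K * σ L * σ M else 0) := by
    intro J hJ K hK L hL M hM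
    split_ifs with hok
    · by_cases hz : σ J = 0 ∨ σ K = 0 ∨ σ L = 0 ∨ σ M = 0
      · have hR : σ J * σ K * σ L * σ M = 0 := by rcases hz with h | h | h | h <;> simp [h]
        have : (fun ω => WJ J ω * WJ K ω * WJ L ω * WJ M ω) =ᵐ[μ] 0 := by
          rcases hz with h | h | h | h
          · filter_upwards [hσ0 J hJ h] with ω hω; simp [hω]
          · filter_upwards [hσ0 K hK h] with ω hω; simp [hω]
          · filter_upwards [hσ0 L hL h] with ω hω; simp [hω]
          · filter_upwards [hσ0 M hM h] with ω hω; simp [hω]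
        rw [hR, integral_congr_ae this]; simp
      · push Not at hz
        have hp : ∀ J, σ J ≠ 0 → 0 < σ J := fun J hJ =>
          lt_of_le_of_ne (Real.sqrt_nonneg _) (Ne.symm hJ)
        have hb' : ∀ J ∈ T, ∫ ω, WJ J ω ^ 4 ∂μ ≤ D * σ J ^ 4 := by
          intro J hJ
          rw [show σ J ^ 4 = (σ J ^ 2) ^ 2 by ring, hσ2]; exact hb J hJ
        exact prod4_bound (h4 J hJ) (h4 K hK) (h4 L hL) (h4 M hM) (hp _ hz.1) (hp _ hz.2.1)
          (hp _ hz.2.2.1) (hp _ hz.2.2.2) (hb' J hJ) (hb' K hK) (hb' L hL) (hb' M hM)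
    · rw [mul_zero]
      apply le_of_eq
      -- an index covered once
      have hgen : ∀ J ∈ T, ∀ K ∈ T, ∀ L ∈ T, ∀ M ∈ T, ¬ J ⊆ K ∪ L ∪ M →
          ∫ ω, WJ J ω * (WJ K ω * WJ L ω * WJ M ω) ∂μ = 0 := by
        intro J hJ K hK L hL M hM hns
        obtain ⟨i, hiJ, hi'⟩ := Finset.not_subset.1 hns
        simp only [Finset.mem_union, not_or] at hi'
        refine h.ortho (hT hJ) hiJ (g := fun ω => WJ K ω * WJ L ω * WJ M ω) ?_ ?_
        · exact ((h.sm (hT hK) (sub_erase hi'.1.1)).mul (h.sm (hT hL) (sub_erase hi'.1.2))).mul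
            (h.sm (hT hM) (sub_erase hi'.2))
        · refine (hi J hJ K hK L hL M hM).congr (Eventually.of_forall fun ω => ?_)
          simp only; ring
      have hcases : ¬ J ⊆ K ∪ L ∪ M ∨ ¬ K ⊆ J ∪ L ∪ M ∨ ¬ L ⊆ J ∪ K ∪ M ∨ ¬ M ⊆ J ∪ K ∪ L := by
        unfold Ok at hok; tauto
      rcases hcases with hc | hc | hc | hc
      · rw [← hgen J hJ K hK L hL M hM hc]; congr 1; ext ω; ring
      · rw [← hgen K hK J hJ L hL M hM hc]; congr 1; ext ω; ring
      · rw [← hgen L hL J hJ K hK M hM hc]; congr 1; ext ω; ring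
      · rw [← hgen M hM J hJ K hK L hL hc]; congr 1; ext ω; ring
  have hcomb := comb_bound d T (fun J hJ => (Finset.mem_powersetCard.1 (hT hJ)).2) σ
  simp_rw [hσ2] at hcomb
  refine le_trans ?_ (mul_le_mul_of_nonneg_left hcomb hD)
  simp only [Finset.mul_sum]
  refine Finset.sum_le_sum fun J hJ => ?_
  rw [integral_finsetSum _ fun K hK =>
    integrable_finsetSum _ fun L hL => integrable_finsetSum _ fun M hM => hi J hJ K hK L hL M hM]
  refine Finset.sum_le_sum fun K hK => ?_
  rw [integral_finsetSum _ fun L hL => integrable_finsetSum _ fun M hM => hi J hJ K hK L hL M hM]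
  refine Finset.sum_le_sum fun L hL => ?_
  rw [integral_finsetSum _ fun M hM => hi J hJ K hK L hL M hM]
  exact Finset.sum_le_sum fun M hM => hterm J hJ K hK L hL M hM
end D2
end DJ

namespace DJ

/-! ### Part D2: the Stein type bound for a fixed sample size -/

/-- The U-statistic. -/
def Ws {Ω ι : Type*} [Fintype ι] (d : ℕ) (WJ : Finset ι → Ω → ℝ) (ω : Ω) : ℝ :=
  ∑ J ∈ Finset.powersetCard d (Finset.univ : Finset ι), WJ J ω

/-- The part of the U-statistic depending on coordinate `i`. -/
def Dl {Ω ι : Type*} [Fintype ι] [DecidableEq ι] (d : ℕ) (WJ : Finset ι → Ω → ℝ) (i : ι)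
    (ω : Ω) : ℝ :=
  ∑ J ∈ (Finset.powersetCard d (Finset.univ : Finset ι)).filter (fun J => i ∈ J), WJ J ω

/-- The part of the U-statistic not depending on coordinate `i`. -/
def Rr {Ω ι : Type*} [Fintype ι] [DecidableEq ι] (d : ℕ) (WJ : Finset ι → Ω → ℝ) (i : ι)
    (ω : Ω) : ℝ :=
  ∑ J ∈ (Finset.powersetCard d (Finset.univ : Finset ι)).filter (fun J => ¬ i ∈ J), WJ J ω

section D3
variable {Ω ι : Type*} [Fintype ι] [DecidableEq ι] {mΩ : MeasurableSpace Ω}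
    {μ : Measure Ω} [IsProbabilityMeasure μ] {𝓜 : ι → MeasurableSpace Ω} {d : ℕ}
    {WJ : Finset ι → Ω → ℝ}

lemma Ws_eq (d : ℕ) (WJ : Finset ι → Ω → ℝ) (i : ι) (ω : Ω) :
    Ws d WJ ω = Rr d WJ i ω + Dl d WJ i ω := by
  unfold Ws Rr Dl
  rw [add_comm, Finset.sum_filter_add_sum_filter_not]

lemma sum_Dl (d : ℕ) (WJ : Finset ι → Ω → ℝ) (ω : Ω) :
    ∑ i, Dl d WJ i ω = d * Ws d WJ ω := by
  unfold Ws Dl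
  simp_rw [Finset.sum_filter]
  rw [Finset.sum_comm, Finset.mul_sum]
  refine Finset.sum_congr rfl fun J hJ => ?_
  rw [← Finset.sum_filter]
  simp [(Finset.mem_powersetCard.1 hJ).2]

lemma Setup.Ws4 (h : Setup μ 𝓜 d WJ) : MemLp (Ws d WJ) 4 μ :=
  memLp_finsetSum _ fun J hJ => h.hL4 J hJ

lemma Setup.Dl4 (h : Setup μ 𝓜 d WJ) (i : ι) : MemLp (Dl d WJ i) 4 μ :=
  memLp_finsetSum _ fun J hJ => h.hL4 J (Finset.filter_subset _ _ hJ)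

lemma Setup.Rr4 (h : Setup μ 𝓜 d WJ) (i : ι) : MemLp (Rr d WJ i) 4 μ :=
  memLp_finsetSum _ fun J hJ => h.hL4 J (Finset.filter_subset _ _ hJ)

lemma Setup.Rr_sm (h : Setup μ 𝓜 d WJ) (i : ι) :
    StronglyMeasurable[FF 𝓜 (Finset.univ.erase i)] (Rr d WJ i) := by
  refine Finset.stronglyMeasurable_fun_sum _ fun J hJ => ?_
  rw [Finset.mem_filter] at hJ
  exact h.sm hJ.1 (sub_erase hJ.2)

lemma Setup.condExp_Dl (h : Setup μ 𝓜 d WJ) (i : ι) :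
    μ[Dl d WJ i|FF 𝓜 (Finset.univ.erase i)] =ᵐ[μ] 0 := by
  have e : Dl d WJ i = ∑ J ∈ (Finset.powersetCard d (Finset.univ : Finset ι)).filter
      (fun J => i ∈ J), WJ J := by
    ext ω; simp [Dl]
  rw [e]
  refine (condExp_finsetSum (fun J hJ => (h.hL4 J (Finset.filter_subset _ _ hJ)).integrable
    (by norm_num)) _).trans ?_
  have : ∀ᵐ ω ∂μ, ∀ J : Finset ι, J ∈ (Finset.powersetCard d (Finset.univ : Finset ι)).filter
      (fun J => i ∈ J) → (μ[WJ J|FF 𝓜 (Finset.univ.erase i)]) ω = 0 := by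
    rw [ae_all_iff]
    intro J
    by_cases hJ : J ∈ (Finset.powersetCard d (Finset.univ : Finset ι)).filter (fun J => i ∈ J)
    · have hJ' := Finset.mem_filter.1 hJ
      filter_upwards [h.condExp_zero hJ'.1 hJ'.2] with ω hω _
      simpa using hω
    · exact Eventually.of_forall fun ω hh => absurd hh hJ
  filter_upwards [this] with ω hω
  rw [Finset.sum_apply, Finset.sum_eq_zero hω]; rfl

lemma Setup.condExp_mul_Dl (h : Setup μ 𝓜 d WJ) (i : ι) {g : Ω → ℝ}
    (hg : StronglyMeasurable[FF 𝓜 (Finset.univ.erase i)] g) (hg2 : MemLp g 2 μ) :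
    μ[fun ω => g ω * Dl d WJ i ω|FF 𝓜 (Finset.univ.erase i)] =ᵐ[μ] 0 := by
  have hD2 : MemLp (Dl d WJ i) 2 μ := (h.Dl4 i).mono_exponent (by norm_num)
  have e := condExp_mul_of_stronglyMeasurable_left (μ := μ) hg (int22 hg2 hD2)
    (hD2.integrable (by norm_num))
  refine EventuallyEq.trans e ?_
  filter_upwards [h.condExp_Dl i] with ω hω
  simp [hω]

lemma Setup.int_mul_Dl (h : Setup μ 𝓜 d WJ) (i : ι) {g : Ω → ℝ}
    (hg : StronglyMeasurable[FF 𝓜 (Finset.univ.erase i)] g) (hg2 : MemLp g 2 μ) :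
    ∫ ω, g ω * Dl d WJ i ω ∂μ = 0 := by
  rw [← integral_condExp (FF_le h.hle (Finset.univ.erase i)),
    integral_congr_ae (h.condExp_mul_Dl i hg hg2)]
  simp

lemma Setup.PP_mul_Dl (h : Setup μ 𝓜 d WJ) (i : ι) {g : Ω → ℝ}
    (hg : StronglyMeasurable[FF 𝓜 (Finset.univ.erase i)] g) (hg2 : MemLp g 2 μ)
    (hgD : MemLp (fun ω => g ω * Dl d WJ i ω) 2 μ) :
    PP μ h.hle i (hgD.toLp _) = hgD.toLp _ := by
  rw [PP_apply]
  have : TT μ (FF_le h.hle (Finset.univ.erase i)) (hgD.toLp _) = 0 := by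
    refine Lp.ext ?_
    refine (TT_ae _ hgD).trans ((h.condExp_mul_Dl i hg hg2).trans ?_)
    exact (Lp.coeFn_zero _ _ _).symm
  rw [this, sub_zero]

lemma mem_lpMeas_toLp {Ω : Type*} {m mΩ : MeasurableSpace Ω} {μ : Measure Ω} {f : Ω → ℝ}
    (h2 : MemLp f 2 μ) (hf : StronglyMeasurable[m] f) : h2.toLp f ∈ lpMeas ℝ ℝ m 2 μ := by
  rw [mem_lpMeas_iff_aestronglyMeasurable]
  exact ⟨f, hf, h2.coeFn_toLp⟩

lemma Setup.PP_free (h : Setup μ 𝓜 d WJ) (i : ι) {f : Ω → ℝ}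
    (hf : StronglyMeasurable[FF 𝓜 (Finset.univ.erase i)] f)
    (h2 : MemLp f 2 μ) : PP μ h.hle i (h2.toLp f) = 0 :=
  PP_of_mem h.hle i _ (Finset.univ.erase i) (by simp) (mem_lpMeas_toLp h2 hf)

lemma deg_toLp_sum {α : Type*} (P : ι → Lp ℝ 2 μ →ₗ[ℝ] Lp ℝ 2 μ) (k : ℕ) (s : Finset ι)
    (t : Finset α) (f : α → Ω → ℝ) (hf : ∀ x ∈ t, MemLp (f x) 2 μ)
    (hD : ∀ x ∈ t, ∀ hm : MemLp (f x) 2 μ, Deg P k s (hm.toLp (f x)))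
    (h : MemLp (fun ω => ∑ x ∈ t, f x ω) 2 μ) : Deg P k s (h.toLp _) := by
  classical
  induction t using Finset.induction_on with
  | empty =>
    have : h.toLp _ = 0 :=
      (MemLp.toLp_congr h MemLp.zero' (by simp)).trans (MemLp.toLp_zero _)
    rw [this]; exact deg_zero _ _ _
  | insert x t hx ih =>
    have h' : MemLp (fun ω => ∑ y ∈ t, f y ω) 2 μ :=
      memLp_finsetSum t fun y hy => hf y (by simp [hy])
    have hfx := hf x (by simp)
    have e : h.toLp _ = hfx.toLp _ + h'.toLp _ := by
      rw [← MemLp.toLp_add]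
      exact MemLp.toLp_congr _ _ (Eventually.of_forall fun ω => by simp [Finset.sum_insert hx])
    rw [e]
    exact deg_add _ _ _ _ _ (hD x (by simp) hfx)
      (ih (fun y hy => hf y (by simp [hy])) (fun y hy => hD y (by simp [hy])) h')

lemma Setup.deg_W (h : Setup μ 𝓜 d WJ) (h2 : MemLp (Ws d WJ) 2 μ) :
    Deg (PP μ h.hle) (2 * d) Finset.univ (h2.toLp _) := by
  refine deg_toLp_sum (PP μ h.hle) _ _ _ WJ
    (fun J hJ => (h.hL4 J hJ).mono_exponent (by norm_num)) ?_ h2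
  intro J hJ hm
  refine deg_of_mem h.hle h.hind J _ _ _ (mem_lpMeas_toLp hm (h.sm hJ (Finset.Subset.refl _))) ?_
  rw [Finset.inter_univ, (Finset.mem_powersetCard.1 hJ).2]; omega

lemma Setup.deg_W2 (h : Setup μ 𝓜 d WJ) (h2 : MemLp (fun ω => Ws d WJ ω ^ 2) 2 μ) :
    Deg (PP μ h.hle) (2 * d) Finset.univ (h2.toLp _) := by
  have e : (fun ω => Ws d WJ ω ^ 2) = fun ω => ∑ p ∈ Finset.powersetCard d (Finset.univ : Finset ι)
      ×ˢ Finset.powersetCard d (Finset.univ : Finset ι), WJ p.1 ω * WJ p.2 ω := by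
    ext ω
    rw [Finset.sum_product, pow_two, Ws, Finset.sum_mul_sum]
  have h2' : MemLp (fun ω => ∑ p ∈ Finset.powersetCard d (Finset.univ : Finset ι)
      ×ˢ Finset.powersetCard d (Finset.univ : Finset ι), WJ p.1 ω * WJ p.2 ω) 2 μ := by
    rw [← e]; exact h2
  rw [MemLp.toLp_congr h2 h2' (by rw [e])]
  refine deg_toLp_sum (PP μ h.hle) _ _ _ (fun (p : Finset ι × Finset ι) ω => WJ p.1 ω * WJ p.2 ω) ?_ ?_ h2'
  · intro p hp
    rw [Finset.mem_product] at hp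
    exact mul44 (h.hL4 _ hp.1) (h.hL4 _ hp.2)
  · intro p hp hm
    rw [Finset.mem_product] at hp
    refine deg_of_mem h.hle h.hind (p.1 ∪ p.2) _ _ _ (mem_lpMeas_toLp hm
      ((h.sm hp.1 Finset.subset_union_left).mul (h.sm hp.2 Finset.subset_union_right))) ?_
    rw [Finset.inter_univ]
    refine (Finset.card_union_le _ _).trans ?_
    rw [(Finset.mem_powersetCard.1 hp.1).2, (Finset.mem_powersetCard.1 hp.2).2]; omega

lemma taylor_bound {f f' : ℝ → ℝ} {B : ℝ} (hf : ∀ x, HasDerivAt f (f' x) x)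
    (hL : ∀ x y, |f' x - f' y| ≤ B * |x - y|) (x y : ℝ) :
    |f x - f y - f' x * (x - y)| ≤ B * |(x - y) ^ 2| := by
  have hB : 0 ≤ B := by
    have := (abs_nonneg _).trans (hL 1 0)
    simpa using this
  have := Convex.norm_image_sub_le_of_norm_hasDerivWithin_le (f := fun z => f z - f' x * z)
    (f' := fun z => f' z - f' x) (s := Set.uIcc x y) (x := y) (y := x) (C := B * |x - y|)
    (fun z _ => ((hf z).sub ((hasDerivAt_id z).const_mul (f' x))).hasDerivWithinAt.congr_deriv
      (by simp)) (fun z hz => ?_) (convex_uIcc x y) Set.right_mem_uIcc Set.left_mem_uIcc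
  · rw [Real.norm_eq_abs, Real.norm_eq_abs] at this
    calc _ = |f x - f' x * x - (f y - f' x * y)| := by ring_nf
      _ ≤ _ := this
      _ = _ := by rw [abs_pow]; ring
  · rw [Real.norm_eq_abs]
    refine (hL z x).trans ?_
    refine mul_le_mul_of_nonneg_left ?_ hB
    rw [abs_sub_comm x y]
    exact Set.abs_sub_left_of_mem_uIcc hz
end D3
end DJ

namespace DJ
section D4
variable {Ω ι : Type*} [Fintype ι] [DecidableEq ι] {mΩ : MeasurableSpace Ω}
    {μ : Measure Ω} [IsProbabilityMeasure μ] {𝓜 : ι → MeasurableSpace Ω} {d : ℕ}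
    {WJ : Finset ι → Ω → ℝ}

lemma memLp_bdd {f : ℝ → ℝ} (hf : Continuous f) {B : ℝ} (hB : ∀ x, |f x| ≤ B) {W : Ω → ℝ}
    (hW : AEStronglyMeasurable W μ) : MemLp (fun ω => f (W ω)) 2 μ :=
  MemLp.of_bound (hf.comp_aestronglyMeasurable hW) B (Eventually.of_forall fun ω => hB _)

lemma norm_sq_toLp {f : Ω → ℝ} (hf : MemLp f 2 μ) :
    ‖hf.toLp f‖ ^ 2 = ∫ ω, f ω ^ 2 ∂μ := by
  rw [← real_inner_self_eq_norm_sq, inner_toLp]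
  simp_rw [pow_two]

lemma Setup.stein (h : Setup μ 𝓜 d WJ) (hd : 1 ≤ d) {ν : ℝ}
    (hmean : ∫ ω, Ws d WJ ω ∂μ = 0) (hvar : ∫ ω, Ws d WJ ω ^ 2 ∂μ = 2 * ν)
    {f f' : ℝ → ℝ} {C B1 B2 : ℝ} (hf : ∀ x, HasDerivAt f (f' x) x) (hf'c : Continuous f')
    (hC : ∀ x, |f x| ≤ C) (hB1 : ∀ x, |f' x| ≤ B1)
    (hB2 : ∀ x y, |f' x - f' y| ≤ B2 * |x - y|) :
    |∫ ω, (2 * (Ws d WJ ω + ν) * f' (Ws d WJ ω) - Ws d WJ ω * f (Ws d WJ ω)) ∂μ|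
      ≤ B1 * √(((∫ ω, Ws d WJ ω ^ 4 ∂μ) - 12 * (∫ ω, Ws d WJ ω ^ 3 ∂μ) - 12 * ν ^ 2 + 48 * ν
          + 2 * ∑ i, ∫ ω, Dl d WJ i ω ^ 4 ∂μ) / 3)
        + 2 * B2 * (√(2 * ν * d) * √(∑ i, ∫ ω, Dl d WJ i ω ^ 4 ∂μ)) := by
  have hB20 : 0 ≤ B2 := by
    have := (abs_nonneg _).trans (hB2 1 0)
    simpa using this
  have hfc : Continuous f := continuous_iff_continuousAt.2 fun x => (hf x).continuousAt
  have W4 := h.Ws4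
  have W2 : MemLp (Ws d WJ) 2 μ := W4.mono_exponent (by norm_num)
  have D4 := h.Dl4
  have D2 : ∀ i, MemLp (Dl d WJ i) 2 μ := fun i => (D4 i).mono_exponent (by norm_num)
  have R4 := h.Rr4
  have R2 : ∀ i, MemLp (Rr d WJ i) 2 μ := fun i => (R4 i).mono_exponent (by norm_num)
  have RD : ∀ i, MemLp (fun ω => Rr d WJ i ω * Dl d WJ i ω) 2 μ := fun i => mul44 (R4 i) (D4 i)
  have O2 : MemLp (fun _ : Ω => (1:ℝ)) 2 μ := memLp_const 1
  set w2 := (sq4 W4).toLp _ with hw2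
  set w := W2.toLp _ with hw
  set o := O2.toLp _ with ho
  set a : ι → Lp ℝ 2 μ := fun i => (sq4 (D4 i)).toLp _ with ha
  set δ : ι → Lp ℝ 2 μ := fun i => (D2 i).toLp _ with hδ
  have hδP : ∀ i, PP μ h.hle i (δ i) = δ i := by
    intro i
    have h1D : MemLp (fun ω => (1:ℝ) * Dl d WJ i ω) 2 μ := by simpa using D2 i
    have := h.PP_mul_Dl i (g := fun _ => (1:ℝ)) stronglyMeasurable_const O2 h1D
    have e : δ i = h1D.toLp _ := MemLp.toLp_congr _ _ (Eventually.of_forall fun ω => by simp)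
    rw [e, this]
  have hwP : ∀ i, PP μ h.hle i w = δ i := by
    intro i
    have e : w = (R2 i).toLp _ + δ i := by
      rw [← MemLp.toLp_add]
      exact MemLp.toLp_congr _ _ (Eventually.of_forall fun ω => Ws_eq d WJ i ω)
    rw [e, map_add, hδP, h.PP_free i (h.Rr_sm i), zero_add]
  have hsδ : ∑ i, δ i = (d:ℝ) • w := by
    rw [← MemLp.toLp_const_smul, ← toLp_sum Finset.univ (fun i => Dl d WJ i) D2
      (memLp_finsetSum _ fun i _ => D2 i)]
    exact MemLp.toLp_congr _ _ (Eventually.of_forall fun ω => by simpa using sum_Dl d WJ ω)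
  have hww : inner ℝ w w = 2 * ν := by
    rw [inner_toLp, ← hvar]; simp_rw [pow_two]
  have hna : ∀ i, ‖a i‖ ^ 2 = ∫ ω, Dl d WJ i ω ^ 4 ∂μ := by
    intro i
    rw [norm_sq_toLp]; congr 1; ext ω; ring
  have hw2w2 : inner ℝ w2 w2 = ∫ ω, Ws d WJ ω ^ 4 ∂μ := by
    rw [inner_toLp]; congr 1; ext ω; ring
  have hw2w : inner ℝ w2 w = ∫ ω, Ws d WJ ω ^ 3 ∂μ := by
    rw [inner_toLp]; congr 1
  have hoo : inner ℝ o o = (1:ℝ) := by rw [inner_toLp]; simp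
  have HB := hilbert_bound (PP μ h.hle) (PP_sym h.hle) (PP_id h.hle) (PP_comm h.hle h.hind) d hd ν
    w2 w o (fun i => (sq4 (R4 i)).toLp _) (fun i => (RD i).toLp _) a
    (fun i => by
      rw [← MemLp.toLp_const_smul, ← MemLp.toLp_add, ← MemLp.toLp_add]
      refine MemLp.toLp_congr _ _ (Eventually.of_forall fun ω => ?_)
      simp only [Pi.add_apply, Pi.smul_apply, smul_eq_mul]
      rw [Ws_eq d WJ i ω]; ring)
    (fun i => h.PP_free i ((h.Rr_sm i).pow 2) (sq4 (R4 i)))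
    (fun i => h.PP_mul_Dl i (h.Rr_sm i) (R2 i) (RD i))
    (fun i => by
      rw [inner_toLp, inner_toLp]; congr 1; ext ω; ring)
    (by
      rw [← MemLp.toLp_const_smul]
      have e : ∀ i, (RD i).toLp _ + a i = ((RD i).add (sq4 (D4 i))).toLp _ :=
        fun i => (MemLp.toLp_add _ _).symm
      simp_rw [e]
      rw [← toLp_sum Finset.univ _ (fun i => (RD i).add (sq4 (D4 i)))
        (memLp_finsetSum _ fun i _ => (RD i).add (sq4 (D4 i)))]
      refine MemLp.toLp_congr _ _ (Eventually.of_forall fun ω => ?_)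
      simp only [Pi.add_apply, Pi.smul_apply, smul_eq_mul]
      have : ∀ i, Rr d WJ i ω * Dl d WJ i ω + Dl d WJ i ω ^ 2 = Ws d WJ ω * Dl d WJ i ω := by
        intro i; rw [Ws_eq d WJ i ω]; ring
      simp_rw [this]
      rw [← Finset.mul_sum, sum_Dl]; ring)
    (by simp_rw [hwP]; exact hsδ)
    (fun i => h.PP_free i stronglyMeasurable_const O2)
    hoo (by rw [inner_toLp]; simpa using hmean) hww
    (by rw [inner_toLp]; simpa using hvar)
    (h.deg_W2 _) (h.deg_W _)
    (deg_of_mem h.hle h.hind ∅ _ _ _ (mem_lpMeas_toLp O2 stronglyMeasurable_const) (by simp))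
  have F2 := memLp_bdd (μ := μ) hf'c hB1 W2.1
  have FR2 := fun i => memLp_bdd (μ := μ) hf'c hB1 (R2 i).1
  have f2 := memLp_bdd (μ := μ) hfc hC W2.1
  have fR2 := fun i => memLp_bdd (μ := μ) hfc hC (R2 i).1
  have FD2 : ∀ i, MemLp (fun ω => f' (Ws d WJ ω) * Dl d WJ i ω) 2 μ := fun i => by
    refine MemLp.of_le_mul (c := B1) (D2 i) (F2.1.mul (D2 i).1) (Eventually.of_forall fun ω => ?_)
    rw [norm_mul]
    exact mul_le_mul_of_nonneg_right (hB1 _) (norm_nonneg _)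
  have e2 : ∀ i, MemLp (fun ω => f (Ws d WJ ω) - f (Rr d WJ i ω)
      - f' (Ws d WJ ω) * Dl d WJ i ω) 2 μ := fun i => (f2.sub (fR2 i)).sub (FD2 i)
  have HS := hilbert_stein (PP μ h.hle) (PP_sym h.hle) (PP_id h.hle) d hd B2 hB20 w
    (f2.toLp _) (F2.toLp _) δ (fun i => (e2 i).toLp _) a (fun i => (fR2 i).toLp _)
    (fun i => (FR2 i).toLp _) hsδ
    (fun i => by
      rw [inner_toLp]
      refine Eq.trans ?_ (h.int_mul_Dl i (g := fun ω => f (Rr d WJ i ω))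
        (hfc.comp_stronglyMeasurable (h.Rr_sm i)) (fR2 i))
      congr 1; ext ω; ring)
    (fun i => by
      rw [← MemLp.toLp_sub, inner_toLp, inner_toLp, inner_toLp, ← integral_add]
      · congr 1; ext ω; simp only [Pi.sub_apply]; ring
      · exact int22 F2 (sq4 (D4 i))
      · exact int22 (D2 i) (e2 i))
    (fun i => norm_toLp_le _ _ _ fun ω => by
      have := taylor_bound hf hB2 (Ws d WJ ω) (Rr d WJ i ω)
      rw [show Ws d WJ ω - Rr d WJ i ω = Dl d WJ i ω by rw [Ws_eq d WJ i ω]; ring] at this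
      exact this)
    (fun i => by
      rw [← MemLp.toLp_sub]
      refine norm_toLp_le _ _ _ fun ω => ?_
      have := hB2 (Ws d WJ ω) (Rr d WJ i ω)
      rw [show Ws d WJ ω - Rr d WJ i ω = Dl d WJ i ω by rw [Ws_eq d WJ i ω]; ring] at this
      exact this)
    (fun i => h.PP_free i (hf'c.comp_stronglyMeasurable (h.Rr_sm i)) (FR2 i))
  set F := F2.toLp _ with hF
  set ff := f2.toLp _ with hff
  set G := (2 * d : ℝ)⁻¹ • (∑ i, ((2:ℝ) • a i - PP μ h.hle i (a i))) with hG
  simp_rw [hna] at HB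
  rw [hw2w2, hw2w] at HB
  have hFn : ‖F‖ ≤ B1 := by
    have := norm_toLp_le F2 O2 B1 (fun ω => by simpa using hB1 _)
    have ho1 : ‖o‖ = 1 := by
      have := real_inner_self_eq_norm_sq o
      rw [hoo] at this
      nlinarith [norm_nonneg o]
    rw [← ho, ho1, mul_one] at this
    exact this
  have hHn : ‖G - (2:ℝ) • w - (2 * ν) • o‖ ≤ √(((∫ ω, Ws d WJ ω ^ 4 ∂μ)
      - 12 * (∫ ω, Ws d WJ ω ^ 3 ∂μ) - 12 * ν ^ 2 + 48 * ν
          + 2 * ∑ i, ∫ ω, Dl d WJ i ω ^ 4 ∂μ) / 3) := by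
    apply Real.le_sqrt_of_sq_le
    linarith
  have hsum : ∑ i, ‖δ i‖ * ‖a i‖ ≤ √(2 * ν * d) * √(∑ i, ∫ ω, Dl d WJ i ω ^ 4 ∂μ) := by
    refine (Real.sum_mul_le_sqrt_mul_sqrt _ _ _).trans (le_of_eq ?_)
    simp_rw [hna]
    congr 2
    calc ∑ i, ‖δ i‖ ^ 2 = ∑ i, inner ℝ (δ i) w := by
          refine Finset.sum_congr rfl fun i _ => ?_
          rw [← real_inner_self_eq_norm_sq]
          conv_rhs => rw [← hδP i, PP_sym, hwP]
      _ = _ := by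
          rw [← sum_inner, hsδ, inner_smul_left, hww]; simp; ring
  have hIntg : ∫ ω, (2 * (Ws d WJ ω + ν) * f' (Ws d WJ ω) - Ws d WJ ω * f (Ws d WJ ω)) ∂μ
      = inner ℝ F ((2:ℝ) • w + (2 * ν) • o) - inner ℝ w ff := by
    rw [← MemLp.toLp_const_smul, ← MemLp.toLp_const_smul, ← MemLp.toLp_add, inner_toLp, inner_toLp,
      ← integral_sub]
    · congr 1; ext ω; simp only [Pi.add_apply, Pi.smul_apply, smul_eq_mul]; ring
    · exact int22 F2 ((W2.const_smul 2).add (O2.const_smul (2 * ν)))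
    · exact int22 W2 f2
  rw [hIntg]
  have hdec : inner ℝ F ((2:ℝ) • w + (2 * ν) • o) - inner ℝ w ff
      = -(inner ℝ F (G - (2:ℝ) • w - (2 * ν) • o)) - (inner ℝ w ff - inner ℝ F G) := by
    simp only [inner_sub_right, inner_add_right]; ring
  rw [hdec]
  refine (abs_sub _ _).trans (add_le_add ?_ ?_)
  · rw [abs_neg]
    refine (abs_real_inner_le_norm _ _).trans ?_
    have : 0 ≤ B1 := (norm_nonneg _).trans hFn
    gcongr
  · refine HS.trans ?_
    gcongr

lemma Setup.kappa (h : Setup μ 𝓜 d WJ) {D ρ : ℝ} (hD : 0 ≤ D)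
    (hb : ∀ J ∈ Finset.powersetCard d (Finset.univ : Finset ι),
      ∫ ω, WJ J ω ^ 4 ∂μ ≤ D * (∫ ω, WJ J ω ^ 2 ∂μ) ^ 2)
    (hρ : ∀ i, ∑ J ∈ (Finset.powersetCard d (Finset.univ : Finset ι)).filter (fun J => i ∈ J),
      ∫ ω, WJ J ω ^ 2 ∂μ ≤ ρ) :
    ∑ i, ∫ ω, Dl d WJ i ω ^ 4 ∂μ
      ≤ 256 ^ d * (D * ρ) * (d * ∫ ω, Ws d WJ ω ^ 2 ∂μ) := by
  have hs : ∫ ω, Ws d WJ ω ^ 2 ∂μ = ∑ J ∈ Finset.powersetCard d (Finset.univ : Finset ι),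
      ∫ ω, WJ J ω ^ 2 ∂μ := h.var_sum _ (Finset.Subset.refl _)
  have hs2 : ∑ i, ∑ J ∈ (Finset.powersetCard d (Finset.univ : Finset ι)).filter (fun J => i ∈ J),
      ∫ ω, WJ J ω ^ 2 ∂μ = d * ∫ ω, Ws d WJ ω ^ 2 ∂μ := by
    rw [hs]
    simp_rw [Finset.sum_filter]
    rw [Finset.sum_comm, Finset.mul_sum]
    refine Finset.sum_congr rfl fun J hJ => ?_
    rw [← Finset.sum_filter]
    simp [(Finset.mem_powersetCard.1 hJ).2]
  rw [← hs2, Finset.mul_sum]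
  refine Finset.sum_le_sum fun i _ => ?_
  set s := ∑ J ∈ (Finset.powersetCard d (Finset.univ : Finset ι)).filter (fun J => i ∈ J),
      ∫ ω, WJ J ω ^ 2 ∂μ with hsdef
  have hs0 : 0 ≤ s := Finset.sum_nonneg fun J _ => integral_nonneg fun ω => by positivity
  refine (h.fourth _ (Finset.filter_subset _ _) D hD
    fun J hJ => hb J (Finset.filter_subset _ _ hJ)).trans ?_
  have e : (256:ℝ) ^ d = (16 ^ d) ^ 2 := by rw [← pow_mul, mul_comm, pow_mul]; norm_num
  rw [e]
  have : s ≤ ρ := hρ i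
  calc D * (16 ^ d * s) ^ 2 = (16 ^ d) ^ 2 * (D * s) * s := by ring
    _ ≤ _ := by gcongr
end D4
end DJ

namespace DJ

/-! ### Part E: characteristic functions -/

/-- The inverse of the characteristic function of the centered gamma law. -/
noncomputable def psi (ν t : ℝ) : ℂ :=
  Complex.exp (((ν / 4 * Real.log (1 + 4 * t ^ 2) : ℝ) : ℂ)
    + ((ν * (t - 2⁻¹ * Real.arctan (2 * t)) : ℝ) : ℂ) * Complex.I)

lemma psi_zero (ν : ℝ) : psi ν 0 = 1 := by simp [psi]

lemma psi_ne (ν t : ℝ) : psi ν t ≠ 0 := Complex.exp_ne_zero _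

lemma psi_norm (ν t : ℝ) : ‖psi ν t‖ = Real.exp (ν / 4 * Real.log (1 + 4 * t ^ 2)) := by
  unfold psi
  rw [Complex.norm_exp, Complex.add_re, Complex.ofReal_re, Complex.re_ofReal_mul, Complex.I_re,
    mul_zero, add_zero]

lemma denom_ne (t : ℝ) : (2 * (t:ℂ) + Complex.I) ≠ 0 := by
  intro h
  have := congrArg Complex.im h
  simp at this

lemma denom_norm (t : ℝ) : 1 ≤ ‖(2 * (t:ℂ) + Complex.I)‖ := by
  have := Complex.abs_im_le_norm (2 * (t:ℂ) + Complex.I)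
  simpa using this

lemma psi_deriv (ν t : ℝ) : HasDerivAt (psi ν)
    (psi ν t * (2 * Complex.I * t * ν / (2 * t + Complex.I))) t := by
  have hp : (0:ℝ) < 1 + 4 * t ^ 2 := by positivity
  have h1 : HasDerivAt (fun t : ℝ => ν / 4 * Real.log (1 + 4 * t ^ 2))
      (ν * (2 * t) / (1 + 4 * t ^ 2)) t := by
    have a1 : HasDerivAt (fun t : ℝ => 1 + 4 * t ^ 2) (8 * t) t :=
      (((hasDerivAt_pow 2 t).const_mul 4).const_add 1).congr_deriv (by simp; ring)
    refine ((a1.log hp.ne').const_mul (ν / 4)).congr_deriv ?_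
    field_simp; ring
  have h2 : HasDerivAt (fun t : ℝ => ν * (t - 2⁻¹ * Real.arctan (2 * t)))
      (ν * (4 * t ^ 2) / (1 + 4 * t ^ 2)) t := by
    have a1 : HasDerivAt (fun t : ℝ => 2 * t) 2 t := by
      simpa using (hasDerivAt_id t).const_mul (2:ℝ)
    refine (((hasDerivAt_id t).sub (a1.arctan.const_mul 2⁻¹)).const_mul ν).congr_deriv ?_
    rw [show 1 + (2 * t) ^ 2 = 1 + 4 * t ^ 2 by ring]
    field_simp; ring
  have h3 := (h1.ofReal_comp.add (h2.ofReal_comp.mul_const Complex.I)).cexp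
  refine h3.congr_deriv ?_
  show psi ν t * _ = _
  congr 1
  have hc : (1 + 4 * (t:ℂ) ^ 2) ≠ 0 := by exact_mod_cast hp.ne'
  have hd := denom_ne t
  push_cast
  rw [div_mul_eq_mul_div, ← add_div, div_eq_div_iff hc hd]
  have hI : Complex.I ^ 2 = -1 := Complex.I_sq
  linear_combination (4 * (t:ℂ) ^ 2 * ν) * hI

lemma charFun_bound {Ω : Type*} {mΩ : MeasurableSpace Ω} {μ : Measure Ω} [IsProbabilityMeasure μ]
    {X : Ω → ℝ} (hX : Integrable X μ) {ν T ε : ℝ} (hν : 0 < ν)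
    (hε : ∀ t : ℝ, |t| ≤ T → ‖∫ ω, (2 * Complex.I * t * (X ω + ν) - X ω)
      * Complex.exp (t * X ω * Complex.I) ∂μ‖ ≤ ε) (t : ℝ) (ht : |t| ≤ T) :
    ‖(∫ ω, Complex.exp (t * X ω * Complex.I) ∂μ) * psi ν t - 1‖
      ≤ ε * Real.exp (ν / 4 * Real.log (1 + 4 * T ^ 2)) * |t| := by
  have hXm := hX.aestronglyMeasurable
  have hXc : AEStronglyMeasurable (fun ω => (X ω : ℂ)) μ :=
    Complex.continuous_ofReal.comp_aestronglyMeasurable hXm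
  have hexpm : ∀ t : ℝ, AEStronglyMeasurable (fun ω => Complex.exp (t * X ω * Complex.I)) μ := by
    intro t
    exact Complex.continuous_exp.comp_aestronglyMeasurable ((hXc.const_mul (t:ℂ)).mul_const _)
  have hnorm : ∀ t x : ℝ, ‖Complex.exp (t * x * Complex.I)‖ = 1 := by
    intro t x
    rw [← Complex.ofReal_mul, Complex.norm_exp_ofReal_mul_I]
  have hexpi : ∀ t : ℝ, Integrable (fun ω => Complex.exp (t * X ω * Complex.I)) μ := by
    intro t
    exact Integrable.of_bound (hexpm t) 1 (Eventually.of_forall fun ω => (hnorm _ _).le)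
  have hder : ∀ t : ℝ, Integrable (fun ω => (X ω * Complex.I) * Complex.exp (t * X ω * Complex.I)) μ
      ∧ HasDerivAt (fun t : ℝ => ∫ ω, Complex.exp (t * X ω * Complex.I) ∂μ)
        (∫ ω, (X ω * Complex.I) * Complex.exp (t * X ω * Complex.I) ∂μ) t := by
    intro t
    refine hasDerivAt_integral_of_dominated_loc_of_deriv_le (𝕜 := ℝ)
      (F := fun (t : ℝ) ω => Complex.exp (t * X ω * Complex.I))
      (F' := fun (t : ℝ) ω => (X ω * Complex.I) * Complex.exp (t * X ω * Complex.I))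
      (bound := fun ω => |X ω|) (s := Set.univ) univ_mem (Eventually.of_forall hexpm) (hexpi t)
      ((hXc.mul_const _).mul (hexpm t)) (Eventually.of_forall fun ω s _ => ?_) hX.abs
      (Eventually.of_forall fun ω s _ => ?_)
    · rw [norm_mul, hnorm, norm_mul]; simp
    · have h0 : HasDerivAt (fun s : ℝ => (s:ℂ) * X ω * Complex.I) (X ω * Complex.I) s := by
        have := ((Complex.ofRealCLM.hasDerivAt (x := s)).mul_const (X ω : ℂ)).mul_const Complex.I
        simpa using this
      refine h0.cexp.congr_deriv ?_
      ring
  set φ : ℝ → ℂ := fun t => ∫ ω, Complex.exp (t * X ω * Complex.I) ∂μ with hφ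
  set err : ℝ → ℂ := fun t => ∫ ω, (2 * Complex.I * t * (X ω + ν) - X ω)
      * Complex.exp (t * X ω * Complex.I) ∂μ with herr
  have hode : ∀ t : ℝ, err t = (2 * t + Complex.I) *
      (∫ ω, (X ω * Complex.I) * Complex.exp (t * X ω * Complex.I) ∂μ)
      + 2 * Complex.I * t * ν * φ t := by
    intro t
    simp only [herr, hφ]
    rw [← integral_const_mul, ← integral_const_mul, ← integral_add]
    · congr 1; ext ω
      have hI : Complex.I ^ 2 = -1 := Complex.I_sq
      linear_combination (-(X ω : ℂ) * Complex.exp (t * X ω * Complex.I)) * hI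
    · exact (hder t).1.const_mul _
    · exact (hexpi t).const_mul _
  have hg : ∀ t : ℝ, HasDerivAt (fun t => φ t * psi ν t)
      (err t * psi ν t / (2 * t + Complex.I)) t := by
    intro t
    refine ((hder t).2.mul (psi_deriv ν t)).congr_deriv ?_
    rw [hode t]
    have hd := denom_ne t
    generalize (∫ ω, (X ω * Complex.I) * Complex.exp (t * X ω * Complex.I) ∂μ) = A
    generalize φ t = p
    rw [eq_div_iff hd]
    field_simp
  have hε0 : 0 ≤ ε := (norm_nonneg _).trans (hε t ht)
  have hT : 0 ≤ T := (abs_nonneg t).trans ht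
  have hmv := Convex.norm_image_sub_le_of_norm_hasDerivWithin_le (s := Set.Icc (-T) T)
    (f := fun t => φ t * psi ν t) (x := 0) (y := t)
    (C := ε * Real.exp (ν / 4 * Real.log (1 + 4 * T ^ 2)))
    (fun s _ => (hg s).hasDerivWithinAt) (fun s hs => ?_) (convex_Icc _ _)
    ⟨by linarith, hT⟩ (abs_le.1 ht)
  · have h0 : φ 0 * psi ν 0 = 1 := by rw [psi_zero]; simp [hφ]
    simp only [h0, sub_zero, Real.norm_eq_abs] at hmv
    exact hmv
  · have hs' : |s| ≤ T := abs_le.2 hs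
    rw [norm_div, norm_mul]
    refine (div_le_self (by positivity) (denom_norm s)).trans ?_
    refine mul_le_mul (hε s hs') ?_ (norm_nonneg _) hε0
    rw [psi_norm]
    have : s ^ 2 ≤ T ^ 2 := sq_le_sq' hs.1 hs.2
    gcongr

lemma gamma_int (a : ℝ) (ha : 0 < a) {f : ℝ → ℂ} :
    ∫ x, f x ∂(gammaMeasure a 1)
      = ∫ x in Set.Ioi (0:ℝ), ((Real.Gamma a)⁻¹ * (x ^ (a - 1) * Real.exp (-x)) : ℝ) • f x := by
  have hm : Measurable (gammaPDF a 1) := (measurable_gammaPDFReal a 1).ennreal_ofReal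
  have hfin : ∀ᵐ x : ℝ, gammaPDF a 1 x < ⊤ := Eventually.of_forall fun x => ENNReal.ofReal_lt_top
  rw [gammaMeasure, integral_withDensity_eq_integral_toReal_smul hm hfin]
  rw [← integral_Ici_eq_integral_Ioi, ← integral_indicator measurableSet_Ici]
  congr 1; ext x
  rw [gammaPDF, ENNReal.toReal_ofReal (gammaPDFReal_nonneg ha one_pos x)]
  by_cases hx : 0 ≤ x
  · rw [Set.indicator_of_mem (Set.mem_Ici.2 hx), gammaPDFReal, if_pos hx]
    congr 1; simp; ring
  · rw [Set.indicator_of_notMem (by simpa using hx), gammaPDFReal, if_neg hx, zero_smul]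

lemma gamma_integrable (a : ℝ) (ha : 0 < a) : Integrable (fun x : ℝ => x) (gammaMeasure a 1) := by
  have hm : Measurable (gammaPDF a 1) := (measurable_gammaPDFReal a 1).ennreal_ofReal
  have hfin : ∀ᵐ x : ℝ, gammaPDF a 1 x < ⊤ := Eventually.of_forall fun x => ENNReal.ofReal_lt_top
  rw [gammaMeasure, integrable_withDensity_iff_integrable_smul' hm hfin]
  have h := Real.GammaIntegral_convergent (s := a + 1) (by linarith)
  rw [← integrableOn_Ici_iff_integrableOn_Ioi] at h
  have h1 : IntegrableOn (fun x => (Real.Gamma a)⁻¹ * (Real.exp (-x) * x ^ (a + 1 - 1)))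
    (Set.Ici 0) := h.const_mul (Real.Gamma a)⁻¹
  have h2 := h1.integrable_indicator measurableSet_Ici
  refine h2.congr (Eventually.of_forall fun x => ?_)
  simp only
  rw [gammaPDF, ENNReal.toReal_ofReal (gammaPDFReal_nonneg ha one_pos x)]
  rcases lt_trichotomy x 0 with hx | hx | hx
  · rw [Set.indicator_of_notMem (by simpa using hx), gammaPDFReal, if_neg (by simpa using hx), zero_smul]
  · subst hx; simp [ha.ne']
  · rw [Set.indicator_of_mem (Set.mem_Ici.2 hx.le), gammaPDFReal, if_pos hx.le]
    rw [add_sub_cancel_right, Real.rpow_sub_one hx.ne']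
    simp
    field_simp

lemma gamma_identity (ν : ℝ) (hν : 0 < ν) (t : ℝ) :
    ∫ x, (2 * Complex.I * t * ((2 * x - ν : ℝ) + ν) - ((2 * x - ν : ℝ) : ℂ))
      * Complex.exp (t * (2 * x - ν : ℝ) * Complex.I) ∂(gammaMeasure (ν / 2) 1) = 0 := by
  have ha : 0 < ν / 2 := by linarith
  rw [gamma_int _ ha]
  set a := ν / 2 with hadef
  set c : ℂ := 1 - 2 * Complex.I * t with hc
  have hnorm : ∀ x : ℝ, ‖Complex.exp (-c * x)‖ = Real.exp (-x) := by
    intro x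
    rw [Complex.norm_exp]; congr 1
    simp [hc]
  set g : ℝ → ℂ := fun x => ((x ^ a : ℝ) : ℂ) * Complex.exp (-c * x) with hg
  set g' : ℝ → ℂ := fun x => ((a * x ^ (a - 1) : ℝ) : ℂ) * Complex.exp (-c * x)
    + ((x ^ a : ℝ) : ℂ) * (Complex.exp (-c * x) * (-c)) with hg'
  have hder : ∀ x ∈ Set.Ioi (0:ℝ), HasDerivAt g (g' x) x := by
    intro x hx
    have h1 := (Real.hasDerivAt_rpow_const (x := x) (p := a) (Or.inl (ne_of_gt hx))).ofReal_comp
    have h0 : HasDerivAt (fun s : ℝ => -c * (s:ℂ)) (-c) x := by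
      have := (Complex.ofRealCLM.hasDerivAt (x := x)).const_mul (-c)
      simpa using this
    exact h1.mul h0.cexp
  have hi1 : IntegrableOn (fun x : ℝ => ((x ^ (a - 1) : ℝ) : ℂ) * Complex.exp (-c * x))
      (Set.Ioi 0) := by
    have h := Real.GammaIntegral_convergent (s := a) ha
    refine Integrable.mono' h ?_ ?_
    · exact (by fun_prop : Measurable _).aestronglyMeasurable
    · filter_upwards [ae_restrict_mem measurableSet_Ioi] with x hx
      rw [norm_mul, hnorm, Complex.norm_real, Real.norm_eq_abs,
        abs_of_nonneg (Real.rpow_nonneg (le_of_lt hx) _), mul_comm]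
  have hi2 : IntegrableOn (fun x : ℝ => ((x ^ a : ℝ) : ℂ) * Complex.exp (-c * x))
      (Set.Ioi 0) := by
    have h := Real.GammaIntegral_convergent (s := a + 1) (by linarith)
    refine Integrable.mono' h ?_ ?_
    · exact (by fun_prop : Measurable _).aestronglyMeasurable
    · filter_upwards [ae_restrict_mem measurableSet_Ioi] with x hx
      rw [norm_mul, hnorm, Complex.norm_real, Real.norm_eq_abs,
        abs_of_nonneg (Real.rpow_nonneg (le_of_lt hx) _), mul_comm, add_sub_cancel_right]
  have hi : IntegrableOn g' (Set.Ioi 0) := by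
    refine ((hi1.const_mul (a:ℂ)).add (hi2.const_mul (-c))).congr (Eventually.of_forall fun x => ?_)
    simp only [hg', Pi.add_apply]; push_cast; ring
  have hcont : ContinuousWithinAt g (Set.Ici 0) 0 := by
    apply Continuous.continuousWithinAt
    refine (Complex.continuous_ofReal.comp (Real.continuous_rpow_const ha.le)).mul ?_
    fun_prop
  have hlim : Tendsto g atTop (𝓝 0) := by
    rw [tendsto_zero_iff_norm_tendsto_zero]
    refine (tendsto_rpow_mul_exp_neg_mul_atTop_nhds_zero a 1 one_pos).congr' ?_
    filter_upwards [eventually_ge_atTop 0] with x hx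
    simp only [hg]
    rw [norm_mul, hnorm, Complex.norm_real, Real.norm_eq_abs,
        abs_of_nonneg (Real.rpow_nonneg hx _)]; simp
  have hfin := integral_Ioi_of_hasDerivAt_of_tendsto hcont hder hi hlim
  have hg0 : g 0 = 0 := by simp [hg, ha.ne']
  rw [hg0, sub_zero] at hfin
  have : ∀ x ∈ Set.Ioi (0:ℝ), ((Real.Gamma a)⁻¹ * (x ^ (a - 1) * Real.exp (-x)) : ℝ) •
      ((2 * Complex.I * t * ((2 * x - ν : ℝ) + ν) - ((2 * x - ν : ℝ) : ℂ))
      * Complex.exp (t * (2 * x - ν : ℝ) * Complex.I))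
      = (2 * (Real.Gamma a)⁻¹ * Complex.exp (-(t * ν * Complex.I))) * g' x := by
    intro x hx
    have e1 : ((x ^ a : ℝ) : ℂ) = ((x ^ (a - 1) : ℝ) : ℂ) * x := by
      rw [← Complex.ofReal_mul]; congr 1
      rw [Real.rpow_sub_one (ne_of_gt hx)]; field_simp [ne_of_gt (Set.mem_Ioi.1 hx)]
    have e2 : Complex.exp (t * (2 * x - ν : ℝ) * Complex.I)
        = Complex.exp (-(t * ν * Complex.I)) * Complex.exp (-c * x) * Complex.exp x := by
      rw [← Complex.exp_add, ← Complex.exp_add]; congr 1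
      rw [hc]; push_cast; ring
    have e3 : ((Real.exp (-x) : ℝ) : ℂ) * Complex.exp x = 1 := by
      rw [Complex.ofReal_exp, ← Complex.exp_add]; simp
    have e4 : (ν : ℂ) = 2 * a := by rw [hadef]; push_cast; ring
    simp only [hg', Complex.real_smul]
    rw [e1, e2]
    push_cast at e3 ⊢
    rw [e4, hc]
    linear_combination (((Real.Gamma a : ℂ))⁻¹ * ((x ^ (a - 1) : ℝ) : ℂ) *
      (2 * Complex.I * t * (2 * x) - (2 * x - 2 * a)) * (Complex.exp (-(t * (2 * a) * Complex.I))
        * Complex.exp (-(1 - 2 * Complex.I * t) * x))) * e3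
  rw [setIntegral_congr_fun measurableSet_Ioi this, integral_const_mul, hfin, mul_zero]
end DJ

namespace DJ

/-! ### Part F: assembly -/

lemma complex_err {Ω : Type*} {mΩ : MeasurableSpace Ω} {μ : Measure Ω} [IsProbabilityMeasure μ]
    {X : Ω → ℝ} (hX : Integrable X μ) (ν t : ℝ) {e1 e2 : ℝ}
    (h1 : |∫ ω, (2 * (X ω + ν) * (-(t * Real.sin (t * X ω))) - X ω * Real.cos (t * X ω)) ∂μ| ≤ e1)
    (h2 : |∫ ω, (2 * (X ω + ν) * (t * Real.cos (t * X ω)) - X ω * Real.sin (t * X ω)) ∂μ| ≤ e2) :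
    ‖∫ ω, (2 * Complex.I * t * (X ω + ν) - X ω)
      * Complex.exp (t * X ω * Complex.I) ∂μ‖ ≤ e1 + e2 := by
  have hb : ∀ (g : ℝ → ℝ) (Y : Ω → ℝ), Continuous g → (∀ x, |g x| ≤ 1) → Integrable Y μ →
      Integrable (fun ω => Y ω * g (t * X ω)) μ := by
    intro g Y hg hg1 hY
    refine hY.mul_bdd (c := 1) (hg.comp_aestronglyMeasurable (hX.aestronglyMeasurable.const_mul t))
      (Eventually.of_forall fun ω => hg1 _)
  have hY : Integrable (fun ω => 2 * (X ω + ν)) μ := (hX.add (integrable_const ν)).const_mul 2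
  have i1 : Integrable (fun ω => 2 * (X ω + ν) * (-(t * Real.sin (t * X ω)))
      - X ω * Real.cos (t * X ω)) μ := by
    refine Integrable.sub ?_ (hb _ _ Real.continuous_cos Real.abs_cos_le_one hX)
    refine ((hb _ _ Real.continuous_sin Real.abs_sin_le_one hY).const_mul (-t)).congr
      (Eventually.of_forall fun ω => ?_)
    simp only; ring
  have i2 : Integrable (fun ω => 2 * (X ω + ν) * (t * Real.cos (t * X ω))
      - X ω * Real.sin (t * X ω)) μ := by
    refine Integrable.sub ?_ (hb _ _ Real.continuous_sin Real.abs_sin_le_one hX)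
    refine ((hb _ _ Real.continuous_cos Real.abs_cos_le_one hY).const_mul t).congr
      (Eventually.of_forall fun ω => ?_)
    simp only; ring
  have e : ∫ ω, (2 * Complex.I * t * (X ω + ν) - X ω) * Complex.exp (t * X ω * Complex.I) ∂μ
      = ((∫ ω, (2 * (X ω + ν) * (-(t * Real.sin (t * X ω))) - X ω * Real.cos (t * X ω)) ∂μ : ℝ) : ℂ)
      + ((∫ ω, (2 * (X ω + ν) * (t * Real.cos (t * X ω)) - X ω * Real.sin (t * X ω)) ∂μ : ℝ) : ℂ)
        * Complex.I := by
    rw [← integral_complex_ofReal, ← integral_complex_ofReal, ← integral_mul_const, ← integral_add]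
    · congr 1; ext ω
      rw [← Complex.ofReal_mul, Complex.exp_mul_I, ← Complex.ofReal_cos, ← Complex.ofReal_sin]
      have hI : Complex.I ^ 2 = -1 := Complex.I_sq
      push_cast
      linear_combination (2 * t * (X ω + ν) * Complex.sin (t * X ω)) * hI
    · exact i1.ofReal
    · exact i2.ofReal.mul_const _
  rw [e]
  refine (norm_add_le _ _).trans (add_le_add ?_ ?_)
  · rw [Complex.norm_real]; exact h1
  · rw [norm_mul, Complex.norm_real, Complex.norm_I, mul_one]; exact h2

lemma Setup.cf_err {Ω ι : Type*} [Fintype ι] [DecidableEq ι] {mΩ : MeasurableSpace Ω}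
    {μ : Measure Ω} [IsProbabilityMeasure μ] {𝓜 : ι → MeasurableSpace Ω} {d : ℕ}
    {WJ : Finset ι → Ω → ℝ} (h : Setup μ 𝓜 d WJ) (hd : 1 ≤ d) {ν : ℝ}
    (hmean : ∫ ω, Ws d WJ ω ∂μ = 0) (hvar : ∫ ω, Ws d WJ ω ^ 2 ∂μ = 2 * ν) {T t : ℝ}
    (ht : |t| ≤ T) :
    ‖∫ ω, (2 * Complex.I * t * (Ws d WJ ω + ν) - Ws d WJ ω)
      * Complex.exp (t * Ws d WJ ω * Complex.I) ∂μ‖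
      ≤ 2 * (T * √(((∫ ω, Ws d WJ ω ^ 4 ∂μ) - 12 * (∫ ω, Ws d WJ ω ^ 3 ∂μ) - 12 * ν ^ 2 + 48 * ν
          + 2 * ∑ i, ∫ ω, Dl d WJ i ω ^ 4 ∂μ) / 3)
        + 2 * T ^ 2 * (√(2 * ν * d) * √(∑ i, ∫ ω, Dl d WJ i ω ^ 4 ∂μ))) := by
  have hT2 : t ^ 2 ≤ T ^ 2 := by
    rw [← sq_abs t]; exact pow_le_pow_left₀ (abs_nonneg _) ht 2
  have hlin : ∀ x : ℝ, HasDerivAt (fun x => t * x) t x := fun x => by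
    simpa using (hasDerivAt_id x).const_mul t
  have lip : ∀ g : ℝ → ℝ, (∀ x y, |g x - g y| ≤ |x - y|) → ∀ x y : ℝ,
      |t * g (t * x) - t * g (t * y)| ≤ t ^ 2 * |x - y| := by
    intro g hg x y
    rw [← mul_sub, abs_mul]
    calc |t| * |g (t * x) - g (t * y)| ≤ |t| * |t * x - t * y| :=
        mul_le_mul_of_nonneg_left (hg _ _) (abs_nonneg _)
      _ = t ^ 2 * |x - y| := by rw [← mul_sub, abs_mul, ← sq_abs t]; ring
  have hle : |t| * √(((∫ ω, Ws d WJ ω ^ 4 ∂μ) - 12 * (∫ ω, Ws d WJ ω ^ 3 ∂μ) - 12 * ν ^ 2 + 48 * ν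
          + 2 * ∑ i, ∫ ω, Dl d WJ i ω ^ 4 ∂μ) / 3)
        + 2 * t ^ 2 * (√(2 * ν * d) * √(∑ i, ∫ ω, Dl d WJ i ω ^ 4 ∂μ))
      ≤ T * √(((∫ ω, Ws d WJ ω ^ 4 ∂μ) - 12 * (∫ ω, Ws d WJ ω ^ 3 ∂μ) - 12 * ν ^ 2 + 48 * ν
          + 2 * ∑ i, ∫ ω, Dl d WJ i ω ^ 4 ∂μ) / 3)
        + 2 * T ^ 2 * (√(2 * ν * d) * √(∑ i, ∫ ω, Dl d WJ i ω ^ 4 ∂μ)) := by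
    gcongr
  have s1 := h.stein hd hmean hvar (f := fun x => Real.cos (t * x))
    (f' := fun x => -(t * Real.sin (t * x))) (C := 1) (B1 := |t|) (B2 := t ^ 2)
    (fun x => (hlin x).cos.congr_deriv (by ring)) (by fun_prop) (fun x => Real.abs_cos_le_one _)
    (fun x => by
      rw [abs_neg, abs_mul]
      exact mul_le_of_le_one_right (abs_nonneg _) (Real.abs_sin_le_one _))
    (fun x y => by
      have := lip Real.sin Real.abs_sin_sub_sin_le y x
      rw [abs_sub_comm x y]
      refine le_trans (le_of_eq ?_) this
      congr 1; ring)
  have s2 := h.stein hd hmean hvar (f := fun x => Real.sin (t * x))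
    (f' := fun x => t * Real.cos (t * x)) (C := 1) (B1 := |t|) (B2 := t ^ 2)
    (fun x => (hlin x).sin.congr_deriv (by ring)) (by fun_prop) (fun x => Real.abs_sin_le_one _)
    (fun x => by
      rw [abs_mul]
      exact mul_le_of_le_one_right (abs_nonneg _) (Real.abs_cos_le_one _))
    (fun x y => lip Real.cos Real.abs_cos_sub_cos_le x y)
  refine le_of_le_of_eq ?_ (two_mul _).symm
  exact complex_err (h.Ws4.integrable (by norm_num)) ν t (s1.trans hle) (s2.trans hle)

lemma limit_of_err {Ω : ℕ → Type} [mΩ : ∀ m, MeasurableSpace (Ω m)]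
    (μ : ∀ m, Measure (Ω m)) [∀ m, IsProbabilityMeasure (μ m)] (W : ∀ m, Ω m → ℝ)
    (hW : ∀ m, Integrable (W m) (μ m)) {ν : ℝ} (hν : 0 < ν) (ε : ℝ → ℕ → ℝ)
    (hε : ∀ T, Tendsto (ε T) atTop (𝓝 0))
    (hb : ∀ T m (t : ℝ), |t| ≤ T → ‖∫ ω, (2 * Complex.I * t * (W m ω + ν) - W m ω)
      * Complex.exp (t * W m ω * Complex.I) ∂(μ m)‖ ≤ ε T m) :
    ∀ f : BoundedContinuousFunction ℝ ℝ,
      Tendsto (fun m => ∫ ω, f (W m ω) ∂(μ m)) atTop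
        (𝓝 (∫ x, f (2 * x - ν) ∂(gammaMeasure (ν / 2) 1))) := by
  have ha : 0 < ν / 2 := by linarith
  have := isProbabilityMeasure_gammaMeasure ha one_pos
  have hWm : ∀ m, AEMeasurable (W m) (μ m) := fun m => (hW m).aemeasurable
  have hZm : Measurable (fun x : ℝ => 2 * x - ν) := by fun_prop
  have hZ : Integrable (fun x : ℝ => 2 * x - ν) (gammaMeasure (ν / 2) 1) :=
    ((gamma_integrable _ ha).const_mul 2).sub (integrable_const ν)
  let L : ℕ → ProbabilityMeasure ℝ := fun m =>
    ⟨(μ m).map (W m), Measure.isProbabilityMeasure_map (hWm m)⟩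
  let L0 : ProbabilityMeasure ℝ :=
    ⟨(gammaMeasure (ν / 2) 1).map (fun x : ℝ => 2 * x - ν),
      Measure.isProbabilityMeasure_map hZm.aemeasurable⟩
  have hc : ∀ t : ℝ, Continuous (fun x : ℝ => Complex.exp (t * x * Complex.I)) := by
    intro t; fun_prop
  have hchar : ∀ t : ℝ, Tendsto (fun m => charFun (L m : Measure ℝ) t) atTop
      (𝓝 (charFun (L0 : Measure ℝ) t)) := by
    intro t
    have e1 : ∀ m, charFun (L m : Measure ℝ) t
        = ∫ ω, Complex.exp (t * W m ω * Complex.I) ∂(μ m) := by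
      intro m
      rw [charFun_apply_real]
      exact integral_map (hWm m) (hc t).aestronglyMeasurable
    have e0 : charFun (L0 : Measure ℝ) t
        = ∫ x, Complex.exp (t * (2 * x - ν : ℝ) * Complex.I) ∂(gammaMeasure (ν / 2) 1) := by
      rw [charFun_apply_real]
      exact integral_map hZm.aemeasurable (hc t).aestronglyMeasurable
    have b0 := charFun_bound hZ hν (T := |t|) (ε := 0)
      (fun s _ => by rw [gamma_identity ν hν s, norm_zero]) t le_rfl
    rw [← e0, zero_mul, zero_mul, norm_le_zero_iff, sub_eq_zero] at b0
    have b1 : ∀ m, ‖charFun (L m : Measure ℝ) t * psi ν t - 1‖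
        ≤ ε |t| m * Real.exp (ν / 4 * Real.log (1 + 4 * |t| ^ 2)) * |t| := by
      intro m
      rw [e1 m]
      exact charFun_bound (hW m) hν (fun s hs => hb |t| m s hs) t le_rfl
    have l1 : Tendsto (fun m => charFun (L m : Measure ℝ) t * psi ν t) atTop (𝓝 1) := by
      rw [tendsto_iff_norm_sub_tendsto_zero]
      refine squeeze_zero (fun m => norm_nonneg _) b1 ?_
      have l3 := ((hε |t|).mul_const
        (Real.exp (ν / 4 * Real.log (1 + 4 * |t| ^ 2)))).mul_const |t|
      rw [zero_mul, zero_mul] at l3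
      exact l3
    have l2 := l1.mul_const (psi ν t)⁻¹
    rw [← b0] at l2
    simp_rw [mul_inv_cancel_right₀ (psi_ne ν t)] at l2
    exact l2
  have hL := ProbabilityMeasure.tendsto_of_tendsto_charFun hchar
  rw [ProbabilityMeasure.tendsto_iff_forall_integral_tendsto] at hL
  intro f
  have := hL f
  have e1 : ∀ m, ∫ x, f x ∂(L m : Measure ℝ) = ∫ ω, f (W m ω) ∂(μ m) := fun m =>
    integral_map (hWm m) f.continuous.aestronglyMeasurable
  have e0 : ∫ x, f x ∂(L0 : Measure ℝ) = ∫ x, f (2 * x - ν) ∂(gammaMeasure (ν / 2) 1) :=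
    integral_map hZm.aemeasurable f.continuous.aestronglyMeasurable
  simp_rw [e1, e0] at this
  exact this
end DJ


/-- Corollary `mtcor`: fix `ν > 0`, an integer `d ≥ 1` and a sequence of
integers `n_m → ∞`.  For each `m`, let `W_m = ∑_{|J| = d} W_J^{(m)}` be a degenerate
`U`-statistic of order `d` based on independent random variables `X₁^{(m)}, …, X_{n_m}^{(m)}`,
with `W_m ∈ L⁴`, `E[W_m] = 0`, `E[W_m²] = 2ν`, and associated quantities `ρ_{n_m}²` and
`D_{n_m}`.  If `E[W_m⁴] − 12 E[W_m³] − 12ν² + 48ν → 0` and `D_{n_m} ρ_{n_m}² → 0`, then `W_m`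
converges in distribution to the centered Gamma variable `Z_ν = 2 X_{ν/2,1} − ν` (convergence
in distribution is expressed by testing against all bounded continuous functions). -/
theorem deJong_gamma_limit
    (ν : ℝ) (hν : 0 < ν) (d : ℕ) (hd : 1 ≤ d)
    (n : ℕ → ℕ) (hn : Tendsto n atTop atTop)
    (Ω : ℕ → Type) [mΩ : ∀ m, MeasurableSpace (Ω m)]
    (μ : ∀ m, Measure (Ω m)) (hprob : ∀ m, IsProbabilityMeasure (μ m))
    (E : ∀ m, Fin (n m) → Type) [mE : ∀ m i, MeasurableSpace (E m i)]
    (X : ∀ m i, Ω m → E m i)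
    (hXmeas : ∀ m i, Measurable (X m i))
    (hindep : ∀ m, iIndepFun (m := fun i => mE m i) (X m) (μ m))
    (WJ : ∀ m, Finset (Fin (n m)) → Ω m → ℝ) (W : ∀ m, Ω m → ℝ)
    (hWdef : ∀ m, W m = fun ω =>
      ∑ J ∈ Finset.powersetCard d (Finset.univ : Finset (Fin (n m))), WJ m J ω)
    (hWJmeas : ∀ m, ∀ J ∈ Finset.powersetCard d (Finset.univ : Finset (Fin (n m))),
      Measurable[⨆ j ∈ J, (mE m j).comap (X m j)] (WJ m J))
    (hWJL4 : ∀ m, ∀ J ∈ Finset.powersetCard d (Finset.univ : Finset (Fin (n m))),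
      MemLp (WJ m J) 4 (μ m))
    (hdegen : ∀ m, ∀ J ∈ Finset.powersetCard d (Finset.univ : Finset (Fin (n m))),
      ∀ K : Finset (Fin (n m)), ¬ J ⊆ K →
        (μ m)[WJ m J|⨆ j ∈ K, (mE m j).comap (X m j)] =ᵐ[μ m] 0)
    (hWL4 : ∀ m, MemLp (W m) 4 (μ m))
    (hWmean : ∀ m, (∫ ω, W m ω ∂(μ m)) = 0)
    (hWvar : ∀ m, (∫ ω, (W m ω) ^ 2 ∂(μ m)) = 2 * ν)
    (ρ2 D : ℕ → ℝ)
    (hρ2 : ∀ m, ρ2 m = sSup {c | ∃ i : Fin (n m),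
      c = ∑ K ∈ (Finset.powersetCard d (Finset.univ : Finset (Fin (n m)))).filter
            (fun K => i ∈ K), variance (WJ m K) (μ m)})
    (hD : ∀ m, D m = sSup {c | ∃ J ∈ Finset.powersetCard d (Finset.univ : Finset (Fin (n m))),
      c = (∫ ω, (WJ m J ω) ^ 4 ∂(μ m)) / (variance (WJ m J) (μ m)) ^ 2})
    (hmom : Tendsto (fun m => (∫ ω, (W m ω) ^ 4 ∂(μ m)) - 12 * (∫ ω, (W m ω) ^ 3 ∂(μ m))
      - 12 * ν ^ 2 + 48 * ν) atTop (𝓝 0))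
    (hDρ : Tendsto (fun m => D m * ρ2 m) atTop (𝓝 0)) :
    ∀ f : BoundedContinuousFunction ℝ ℝ,
      Tendsto (fun m => ∫ ω, f (W m ω) ∂(μ m)) atTop
        (𝓝 (∫ x, f (2 * x - ν) ∂(gammaMeasure (ν / 2) 1))) := by
  have := hprob
  have S : ∀ m, DJ.Setup (μ m) (fun j => (mE m j).comap (X m j)) d (WJ m) := fun m =>
    ⟨fun i => (hXmeas m i).comap_le, hindep m, hWJmeas m, hWJL4 m, hdegen m⟩
  have hWeq : W = fun m => DJ.Ws d (WJ m) := funext fun m => hWdef m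
  subst hWeq
  have hvareq : ∀ m, ∀ J ∈ Finset.powersetCard d (Finset.univ : Finset (Fin (n m))),
      variance (WJ m J) (μ m) = ∫ ω, WJ m J ω ^ 2 ∂(μ m) := fun m J hJ =>
    variance_of_integral_eq_zero (hWJL4 m J hJ).1.aemeasurable ((S m).mean_zero hd hJ)
  have hD0 : ∀ m, 0 ≤ D m := by
    intro m
    rw [hD m]
    apply Real.sSup_nonneg
    rintro c ⟨J, -, rfl⟩
    exact div_nonneg (integral_nonneg fun ω => by positivity) (sq_nonneg _)
  have hb : ∀ m, ∀ J ∈ Finset.powersetCard d (Finset.univ : Finset (Fin (n m))),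
      ∫ ω, WJ m J ω ^ 4 ∂(μ m) ≤ D m * (∫ ω, WJ m J ω ^ 2 ∂(μ m)) ^ 2 := by
    intro m J hJ
    have hIntg : Integrable (fun ω => WJ m J ω ^ 2) (μ m) :=
      ((hWJL4 m J hJ).mono_exponent (by norm_num)).integrable_sq
    by_cases h0 : ∫ ω, WJ m J ω ^ 2 ∂(μ m) = 0
    · rw [h0]
      have h1 := (integral_eq_zero_iff_of_nonneg (fun ω => sq_nonneg (WJ m J ω)) hIntg).1 h0
      have h2 : ∫ ω, WJ m J ω ^ 4 ∂(μ m) = 0 := by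
        apply integral_eq_zero_of_ae
        filter_upwards [h1] with ω hω
        have h3 : WJ m J ω ^ 2 = 0 := hω
        change WJ m J ω ^ 4 = 0
        have : WJ m J ω = 0 := by simpa using h3
        rw [this]; norm_num
      rw [h2]; simp
    · have hpos : 0 < (∫ ω, WJ m J ω ^ 2 ∂(μ m)) ^ 2 := by positivity
      rw [← div_le_iff₀ hpos, hD m]
      apply le_csSup
      · apply Set.Finite.bddAbove
        refine ((Finset.powersetCard d (Finset.univ : Finset (Fin (n m)))).finite_toSet.image
          (fun J => (∫ ω, (WJ m J ω) ^ 4 ∂(μ m)) / (variance (WJ m J) (μ m)) ^ 2)).subset ?_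
        rintro c ⟨J, hJ, rfl⟩
        exact ⟨J, hJ, rfl⟩
      · exact ⟨J, hJ, by rw [hvareq m J hJ]⟩
  have hρ : ∀ m, ∀ i, ∑ J ∈ (Finset.powersetCard d (Finset.univ : Finset (Fin (n m)))).filter
      (fun J => i ∈ J), ∫ ω, WJ m J ω ^ 2 ∂(μ m) ≤ ρ2 m := by
    intro m i
    rw [hρ2 m]
    apply le_csSup
    · apply Set.Finite.bddAbove
      refine (Set.finite_range (fun i : Fin (n m) =>
        ∑ K ∈ (Finset.powersetCard d (Finset.univ : Finset (Fin (n m)))).filter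
            (fun K => i ∈ K), variance (WJ m K) (μ m))).subset ?_
      rintro c ⟨i, rfl⟩
      exact ⟨i, rfl⟩
    · exact ⟨i, Finset.sum_congr rfl fun J hJ =>
        (hvareq m J (Finset.filter_subset _ _ hJ)).symm⟩
  have hκ : Tendsto (fun m => ∑ i, ∫ ω, DJ.Dl d (WJ m) i ω ^ 4 ∂(μ m)) atTop (𝓝 0) := by
    refine squeeze_zero (g := fun m => 256 ^ d * (D m * ρ2 m) * (d * (2 * ν)))
      (fun m => Finset.sum_nonneg fun i _ => integral_nonneg fun ω => by positivity)
      (fun m => ?_) ?_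
    · have := (S m).kappa (hD0 m) (hb m) (hρ m)
      rwa [hWvar m] at this
    · have := (hDρ.const_mul ((256 : ℝ) ^ d)).mul_const ((d : ℝ) * (2 * ν))
      simpa using this
  refine DJ.limit_of_err μ _ (fun m => (hWL4 m).integrable (by norm_num)) hν
    (fun T m => 2 * (T * √(((∫ ω, DJ.Ws d (WJ m) ω ^ 4 ∂(μ m))
          - 12 * (∫ ω, DJ.Ws d (WJ m) ω ^ 3 ∂(μ m)) - 12 * ν ^ 2 + 48 * ν
          + 2 * ∑ i, ∫ ω, DJ.Dl d (WJ m) i ω ^ 4 ∂(μ m)) / 3)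
        + 2 * T ^ 2 * (√(2 * ν * d) * √(∑ i, ∫ ω, DJ.Dl d (WJ m) i ω ^ 4 ∂(μ m))))) ?_ ?_
  · intro T
    have h1 := (((hmom.add (hκ.const_mul 2)).div_const 3).sqrt).const_mul T
    have h2 := ((hκ.sqrt).const_mul (√(2 * ν * d))).const_mul (2 * T ^ 2)
    have h3 := (h1.add h2).const_mul 2
    simpa using h3
  · intro T m t ht
    exact (S m).cf_err hd (hWmean m) (hWvar m) ht
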